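/- Every connected toroidal simple graph with no 4-cycles has a vertex of degree at most 3, or contains a κ-cap-subgraph for some κ ≥ 5. -/

import Mathlib

open unitInterval in
/-- A graph is toroidal if it has a topological embedding into the torus
`(ℝ/ℤ) × (ℝ/ℤ)`: vertices are mapped injectively, each edge is realized by a path
between the images of its endpoints, the interior of an edge avoids all vertex images,
and the interiors of curves of distinct edges are disjoint. -/
def SimpleGraph.IsToroidal {V : Type*} (G : SimpleGraph V) : Prop :=
  ∃ (p : V → AddCircle (1 : ℝ) × AddCircle (1 : ℝ))
    (γ : ∀ u v, G.Adj u v → _root_.Path (p u) (p v)),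
    Function.Injective p ∧
    (∀ u v (h : G.Adj u v) (t : unitInterval), t ≠ 0 → t ≠ 1 → ∀ w, γ u v h t ≠ p w) ∧
    (∀ u v (h : G.Adj u v) u' v' (h' : G.Adj u' v'), s(u, v) ≠ s(u', v') →
      ∀ (t t' : unitInterval), t ≠ 0 → t ≠ 1 → t' ≠ 0 → t' ≠ 1 →
        γ u v h t ≠ γ u' v' h' t')

/-- `G` has a `κ`-cap-subgraph: a chordless cycle `c 0, c 1, …, c (κ-1)` together with an
extra vertex `x` adjacent to exactly the two adjacent cycle vertices `c 0` and `c 1`,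
such that all these vertices have degree exactly `4` in `G`. -/
def HasCapSubgraph {V : Type*} [Fintype V] (G : SimpleGraph V) [DecidableRel G.Adj]
    (κ : ℕ) : Prop :=
  ∃ (c : ZMod κ → V) (x : V),
    Function.Injective c ∧
    (∀ i, G.Adj (c i) (c (i + 1))) ∧
    (∀ i j : ZMod κ, j ≠ i → j ≠ i + 1 → j ≠ i - 1 → ¬ G.Adj (c i) (c j)) ∧
    (∀ i, x ≠ c i) ∧
    G.Adj x (c 0) ∧ G.Adj x (c 1) ∧
    (∀ i : ZMod κ, i ≠ 0 → i ≠ 1 → ¬ G.Adj x (c i)) ∧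
    G.degree x = 4 ∧ (∀ i, G.degree (c i) = 4)

namespace ToroidalC4

open Equiv Equiv.Perm

/-- The number of classes of an equivalence relation. -/
noncomputable def classCount {D : Type*} (r : Setoid D) : ℕ := Nat.card (Quotient r)

/-- The equivalence relation generated by identifying two points. -/
def pairSetoid {D : Type*} (x y : D) : Setoid D :=
  Relation.EqvGen.setoid fun u v => u = x ∧ v = y

lemma pairSetoid_le_iff {D : Type*} {x y : D} {r : Setoid D} : pairSetoid x y ≤ r ↔ r x y := by
  refine ⟨fun h => h (Relation.EqvGen.rel _ _ ⟨rfl, rfl⟩), fun h => ?_⟩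
  refine Setoid.eqvGen_le ?_
  rintro _ _ ⟨rfl, rfl⟩
  exact h

lemma pairSetoid_rel {D : Type*} (x y : D) : pairSetoid x y x y :=
  pairSetoid_le_iff.1 le_rfl

lemma sup_pairSetoid_iff {D : Type*} (r : Setoid D) (x y u v : D) :
    (r ⊔ pairSetoid x y) u v ↔ r u v ∨ (r u x ∧ r y v) ∨ (r u y ∧ r x v) := by
  constructor
  · let t : Setoid D :=
      { r := fun u v => r u v ∨ (r u x ∧ r y v) ∨ (r u y ∧ r x v)
        iseqv :=
          { refl := fun u => Or.inl (r.refl' u)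
            symm := by
              rintro u v (h | ⟨h, h'⟩ | ⟨h, h'⟩)
              · exact Or.inl (r.symm' h)
              · exact Or.inr (Or.inr ⟨r.symm' h', r.symm' h⟩)
              · exact Or.inr (Or.inl ⟨r.symm' h', r.symm' h⟩)
            trans := by
              have tr : ∀ {a b c}, r a b → r b c → r a c := fun h h' => r.trans' h h'
              have sy : ∀ {a b}, r a b → r b a := fun h => r.symm' h
              rintro u v w (h | ⟨h, h'⟩ | ⟨h, h'⟩) (k | ⟨k, k'⟩ | ⟨k, k'⟩)
              · exact Or.inl (tr h k)
              · exact Or.inr (Or.inl ⟨tr h k, k'⟩)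
              · exact Or.inr (Or.inr ⟨tr h k, k'⟩)
              · exact Or.inr (Or.inl ⟨h, tr h' k⟩)
              · exact Or.inr (Or.inl ⟨h, k'⟩)
              · exact Or.inl (tr h k')
              · exact Or.inr (Or.inr ⟨h, tr h' k⟩)
              · exact Or.inl (tr h k')
              · exact Or.inr (Or.inr ⟨h, k'⟩) } }
    have : r ⊔ pairSetoid x y ≤ t :=
      sup_le (fun {a b} h => Or.inl h)
        (pairSetoid_le_iff.2 (Or.inr (Or.inl ⟨r.refl' x, r.refl' y⟩)))
    exact fun h => this h
  · have hr : r ≤ r ⊔ pairSetoid x y := le_sup_left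
    have hp : (r ⊔ pairSetoid x y) x y := pairSetoid_le_iff.1 le_sup_right
    rintro (h | ⟨h, h'⟩ | ⟨h, h'⟩)
    · exact hr h
    · exact Setoid.trans' _ (hr h) (Setoid.trans' _ hp (hr h'))
    · exact Setoid.trans' _ (hr h) (Setoid.trans' _ (Setoid.symm' _ hp) (hr h'))

lemma sup_pairSetoid_eq {D : Type*} {r : Setoid D} {x y : D} (h : r x y) :
    r ⊔ pairSetoid x y = r :=
  sup_eq_left.2 (pairSetoid_le_iff.2 h)

lemma classCount_mono {D : Type*} [Finite D] {r s : Setoid D} (h : r ≤ s) :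
    classCount s ≤ classCount r :=
  Nat.card_le_card_of_surjective (Quotient.map id fun _ _ hab => h hab) (by
    rintro ⟨a⟩
    exact ⟨Quotient.mk r a, rfl⟩)

lemma classCount_le_sup_pair {D : Type*} [Finite D] (r : Setoid D) (x y : D) :
    classCount r ≤ classCount (r ⊔ pairSetoid x y) + 1 := by
  classical
  let g : Quotient r → Option (Quotient (r ⊔ pairSetoid x y)) := fun q =>
    if q = Quotient.mk r y then none
    else some (Quotient.map id (fun _ _ hab => le_sup_left (a := r) hab) q)
  have hg : Function.Injective g := by
    rintro ⟨a⟩ ⟨b⟩ hab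
    change g (Quotient.mk r a) = g (Quotient.mk r b) at hab
    change Quotient.mk r a = Quotient.mk r b
    by_cases ha : Quotient.mk r a = Quotient.mk r y <;>
      by_cases hb : Quotient.mk r b = Quotient.mk r y
    · rw [ha, hb]
    · simp [g, ha, hb] at hab
    · simp [g, ha, hb] at hab
    · simp only [g, ha, hb, if_false, Option.some.injEq] at hab
      have h := Quotient.exact hab
      rcases (sup_pairSetoid_iff r x y a b).1 h with h | ⟨_, h⟩ | ⟨h, _⟩
      · exact Quotient.sound h
      · exact absurd (Quotient.sound (r.symm' h)) hb
      · exact absurd (Quotient.sound h) ha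
  have := Nat.card_le_card_of_injective g hg
  rwa [Finite.card_option] at this

lemma classCount_sup_pair {D : Type*} [Finite D] {r : Setoid D} {x y : D} (h : ¬ r x y) :
    classCount (r ⊔ pairSetoid x y) + 1 = classCount r := by
  refine le_antisymm ?_ (classCount_le_sup_pair r x y)
  by_contra! hlt
  let g : Quotient r → Quotient (r ⊔ pairSetoid x y) :=
    Quotient.map id fun _ _ hab => le_sup_left (a := r) hab
  have hs : Function.Surjective g := by
    rintro ⟨a⟩
    exact ⟨Quotient.mk r a, rfl⟩
  have hc : Nat.card (Quotient r) = Nat.card (Quotient (r ⊔ pairSetoid x y)) :=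
    le_antisymm (Nat.le_of_lt_succ hlt) (Nat.card_le_card_of_surjective g hs)
  have hb := (Nat.bijective_iff_surjective_and_card g).2 ⟨hs, hc⟩
  refine h (Quotient.exact (hb.1 (?_ : g (Quotient.mk r x) = g (Quotient.mk r y))))
  exact Quotient.sound (pairSetoid_le_iff.1 le_sup_right)

/-- The partition into cycles of a permutation. -/
abbrev cyc {D : Type*} (f : Perm D) : Setoid D := SameCycle.setoid f

lemma cyc_iff {D : Type*} {f : Perm D} {x y : D} : cyc f x y ↔ SameCycle f x y := Iff.rfl

lemma cyc_apply {D : Type*} (f : Perm D) (x : D) : cyc f x (f x) :=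
  sameCycle_apply_right.2 (SameCycle.refl f x)

lemma cyc_le_iff {D : Type*} {f : Perm D} {r : Setoid D} : cyc f ≤ r ↔ ∀ x, r x (f x) := by
  refine ⟨fun h x => h (cyc_apply f x), fun h => ?_⟩
  rintro x _ ⟨n, rfl⟩
  have key : ∀ (n : ℕ) (x : D), r x ((f ^ n) x) := by
    intro n
    induction n with
    | zero => exact fun x => r.refl' x
    | succ n ih =>
      intro x
      rw [pow_succ']
      exact r.trans' (ih x) (h _)
  cases n with
  | ofNat n => exact key n x
  | negSucc n =>
    refine r.symm' ?_
    have := key (n + 1) ((f ^ Int.negSucc n) x)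
    rwa [zpow_negSucc, show (f ^ (n + 1)) ((f ^ (n + 1))⁻¹ x) = x from apply_symm_apply _ _] at this

lemma cyc_inv {D : Type*} (f : Perm D) : cyc f⁻¹ = cyc f := by
  ext x y
  exact sameCycle_inv

lemma cyc_mul_le {D : Type*} (f g : Perm D) : cyc (f * g) ≤ cyc f ⊔ cyc g := by
  refine cyc_le_iff.2 fun x => ?_
  have h1 : cyc f ≤ cyc f ⊔ cyc g := le_sup_left
  have h2 : cyc g ≤ cyc f ⊔ cyc g := le_sup_right
  exact Setoid.trans' _ (h2 (cyc_apply g x)) (h1 (cyc_apply f (g x)))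

lemma cyc_swap_le {D : Type*} [DecidableEq D] (x y : D) : cyc (swap x y) ≤ pairSetoid x y := by
  refine cyc_le_iff.2 fun u => ?_
  by_cases hx : u = x
  · subst hx
    rw [swap_apply_left]
    exact pairSetoid_rel _ _
  by_cases hy : u = y
  · subst hy
    rw [swap_apply_right]
    exact Setoid.symm' _ (pairSetoid_rel _ _)
  rw [swap_apply_of_ne_of_ne hx hy]

lemma cyc_swap_mul_sup {D : Type*} [DecidableEq D] (f : Perm D) (x y : D) :
    cyc (swap x y * f) ⊔ pairSetoid x y = cyc f ⊔ pairSetoid x y := by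
  have key : ∀ f : Perm D, cyc (swap x y * f) ⊔ pairSetoid x y ≤ cyc f ⊔ pairSetoid x y := by
    intro f
    refine sup_le ((cyc_mul_le _ _).trans (sup_le ?_ le_sup_left)) le_sup_right
    exact (cyc_swap_le x y).trans le_sup_right
  refine le_antisymm (key f) ?_
  simpa using key (swap x y * f)

lemma cyc_mul_swap_sup {D : Type*} [DecidableEq D] (f : Perm D) (x y : D) :
    cyc (f * swap x y) ⊔ pairSetoid x y = cyc f ⊔ pairSetoid x y := by
  rw [← cyc_inv, mul_inv_rev, swap_inv, cyc_swap_mul_sup, cyc_inv]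

/-- Multiplying by a transposition joins two different cycles. -/
lemma cyc_swap_mul_of_not {D : Type*} [DecidableEq D] [Finite D] {f : Perm D} {x y : D}
    (h : ¬ cyc f x y) : cyc (swap x y * f) x y := by
  classical
  have hex : ∃ n, 0 < n ∧ (f ^ n) x = x :=
    ⟨orderOf f, orderOf_pos f, by rw [pow_orderOf_eq_one]; rfl⟩
  obtain ⟨hpos, hn⟩ := Nat.find_spec hex
  have hmin := fun m => Nat.find_min hex (m := m)
  generalize Nat.find hex = n at hpos hn hmin
  have hk : ∀ k < n, ((swap x y * f) ^ k) x = (f ^ k) x := by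
    intro k
    induction k with
    | zero => simp
    | succ k ih =>
      intro hk
      rw [pow_succ', Perm.mul_apply, ih (by omega), Perm.mul_apply, ← Perm.mul_apply f,
        ← pow_succ']
      refine swap_apply_of_ne_of_ne (fun hx => hmin _ hk ⟨by omega, hx⟩) fun hy => h ?_
      exact ⟨(k + 1 : ℕ), by rw [zpow_natCast]; exact hy⟩
  refine ⟨(n : ℕ), ?_⟩
  obtain ⟨m, rfl⟩ := Nat.exists_eq_succ_of_ne_zero hpos.ne'
  rw [zpow_natCast, pow_succ', Perm.mul_apply, hk m (Nat.lt_succ_self m), Perm.mul_apply,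
    ← Perm.mul_apply f, ← pow_succ', hn, swap_apply_left]

lemma cyc_mul_swap_of_not {D : Type*} [DecidableEq D] [Finite D] {f : Perm D} {x y : D}
    (h : ¬ cyc f x y) : cyc (f * swap x y) x y := by
  rw [← cyc_inv, mul_inv_rev, swap_inv]
  exact cyc_swap_mul_of_not (by rwa [cyc_inv])

/-- The number of cycles of a permutation, fixed points included. -/
noncomputable abbrev cycCount {D : Type*} (f : Perm D) : ℕ := classCount (cyc f)

/-- Moving a transposition that isolates a point of a cycle of `a` from `a` to `b`
does not decrease the Euler characteristic. -/
lemma transfer {D : Type*} [DecidableEq D] [Finite D] (a b c : Perm D) (d : D) :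
    cycCount a + cycCount b + cycCount c +
        2 * classCount (cyc (a * swap d (a⁻¹ d)) ⊔ cyc (swap d (a⁻¹ d) * b) ⊔ cyc c) ≤
      cycCount (a * swap d (a⁻¹ d)) + cycCount (swap d (a⁻¹ d) * b) + cycCount c +
        2 * classCount (cyc a ⊔ cyc b ⊔ cyc c) := by
  by_cases hd : a⁻¹ d = d
  · have : swap d d = (1 : Perm D) := swap_self d
    rw [hd, this, mul_one, one_mul]
  have hA : cyc a d (a⁻¹ d) := by
    have := cyc_apply a⁻¹ d
    rwa [cyc_inv] at this
  generalize hy : a⁻¹ d = y at *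
  have hfix : (a * swap d y) d = d := by
    rw [Perm.mul_apply, swap_apply_left, ← hy]
    exact apply_symm_apply a d
  have hA' : ¬ cyc (a * swap d y) d y := by
    rintro ⟨n, hn⟩
    rw [zpow_apply_eq_self_of_apply_eq_self hfix] at hn
    exact hd hn.symm
  have e1 := classCount_sup_pair hA'
  rw [cyc_mul_swap_sup, sup_pairSetoid_eq hA] at e1
  have hC : (cyc (a * swap d y) ⊔ cyc (swap d y * b) ⊔ cyc c) ⊔ pairSetoid d y =
      cyc a ⊔ cyc b ⊔ cyc c := by
    calc _ = (cyc (a * swap d y) ⊔ pairSetoid d y) ⊔ (cyc (swap d y * b) ⊔ pairSetoid d y)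
          ⊔ cyc c := by
          rw [← sup_sup_distrib_right]; ac_rfl
      _ = cyc a ⊔ pairSetoid d y ⊔ (cyc b) ⊔ cyc c := by
          rw [cyc_mul_swap_sup, cyc_swap_mul_sup, ← sup_sup_distrib_right]; ac_rfl
      _ = _ := by rw [sup_pairSetoid_eq hA]
  have hB := cyc_swap_mul_sup b d y
  by_cases h : (cyc (a * swap d y) ⊔ cyc (swap d y * b) ⊔ cyc c) d y
  · rw [sup_pairSetoid_eq h] at hC
    have h1 := classCount_le_sup_pair (cyc b) d y
    have h2 : classCount (cyc (swap d y * b) ⊔ pairSetoid d y) ≤ _ :=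
      classCount_mono (r := cyc (swap d y * b)) le_sup_left
    rw [hB] at h2
    rw [hC]
    simp only [cycCount]
    omega
  · have e2 := classCount_sup_pair h
    rw [hC] at e2
    have hB' : ¬ cyc (swap d y * b) d y := fun hh =>
      h (Setoid.le_def.1 (le_sup_of_le_left le_sup_right) hh)
    have hb : cyc b d y := by
      have := cyc_swap_mul_of_not hB'
      rwa [swap_mul_self_mul] at this
    have e3 := classCount_sup_pair hB'
    rw [hB, sup_pairSetoid_eq hb] at e3
    simp only [cycCount]
    omega

/-- Two permutations, thought of as rotation and edge permutation of a combinatorial map,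
have genus at most one. -/
def GenusLeOne {D : Type*} (σ α : Perm D) : Prop :=
  Nat.card D + 2 * classCount (cyc σ ⊔ cyc α) ≤
    cycCount σ + cycCount α + cycCount (σ * α) + 2

lemma cyc_sup_mul {D : Type*} (σ α : Perm D) :
    cyc σ ⊔ cyc α ⊔ cyc (σ * α) = cyc σ ⊔ cyc α :=
  sup_eq_left.2 (cyc_mul_le σ α)

lemma GenusLeOne.transfer_right {D : Type*} [DecidableEq D] [Finite D] {σ α : Perm D}
    (h : GenusLeOne σ α) (d : D) :
    GenusLeOne (σ * swap d (α d)) (swap d (α d) * α) := by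
  have key := transfer α⁻¹ σ⁻¹ (σ * α) d
  have e1 : α⁻¹ * swap d (α d) = (swap d (α d) * α)⁻¹ := by simp
  have e2 : swap d (α d) * σ⁻¹ = (σ * swap d (α d))⁻¹ := by simp
  have e3 : σ * swap d (α d) * (swap d (α d) * α) = σ * α := by
    rw [mul_assoc, swap_mul_self_mul]
  have e4 := cyc_sup_mul (σ * swap d (α d)) (swap d (α d) * α)
  rw [e3] at e4
  simp only [inv_inv, e1, e2, cycCount, cyc_inv] at key
  rw [sup_comm (cyc (swap d (α d) * α)), e4, sup_comm (cyc α), cyc_sup_mul] at key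
  unfold GenusLeOne at h ⊢
  rw [e3]
  simp only [cycCount] at h ⊢
  omega

lemma GenusLeOne.skip_left {D : Type*} [DecidableEq D] [Finite D] {σ α : Perm D}
    (h : GenusLeOne σ α) (d : D) : GenusLeOne (swap d (σ d) * σ) α := by
  have key := transfer σ⁻¹ (σ * α) α d
  have e1 : σ⁻¹ * swap d (σ d) = (swap d (σ d) * σ)⁻¹ := by simp
  have e4 := cyc_sup_mul (swap d (σ d) * σ) α
  rw [mul_assoc] at e4
  simp only [inv_inv, e1, cycCount, cyc_inv] at key
  rw [sup_right_comm, e4, sup_right_comm, cyc_sup_mul] at key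
  unfold GenusLeOne at h ⊢
  rw [mul_assoc]
  simp only [cycCount] at h ⊢
  omega

lemma GenusLeOne.skip_right {D : Type*} [DecidableEq D] [Finite D] {σ α : Perm D}
    (h : GenusLeOne σ α) (d : D) : GenusLeOne σ (α * swap d (α⁻¹ d)) := by
  have key := transfer α (σ * α)⁻¹ σ d
  have e1 : swap d (α⁻¹ d) * (σ * α)⁻¹ = (σ * (α * swap d (α⁻¹ d)))⁻¹ := by simp [mul_assoc]
  have e4 := cyc_sup_mul σ (α * swap d (α⁻¹ d))
  simp only [e1, cycCount, cyc_inv] at key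
  rw [sup_comm, ← sup_assoc, e4, sup_comm _ (cyc σ), ← sup_assoc, cyc_sup_mul] at key
  unfold GenusLeOne at h ⊢
  simp only [cycCount] at h ⊢
  omega

/-- Taking a point out of its cycle does not affect the other cycle relations. -/
lemma cyc_skip_iff {D : Type*} [DecidableEq D] (f : Perm D) {d x y : D} (hx : x ≠ d)
    (hy : y ≠ d) : cyc (swap d (f d) * f) x y ↔ cyc f x y := by
  by_cases hd : f d = d
  · have : swap d d = (1 : Perm D) := swap_self d
    rw [hd, this, one_mul]
  constructor
  · have : cyc (swap d (f d) * f) ≤ cyc f := by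
      have := cyc_swap_mul_sup f d (f d)
      rw [sup_pairSetoid_eq (cyc_apply f d)] at this
      exact this ▸ le_sup_left
    exact fun h => this h
  · intro h
    let g : D → D := fun u => if u = d then f d else u
    have key : cyc f ≤ Setoid.comap g (cyc (swap d (f d) * f)) := by
      refine cyc_le_iff.2 fun u => ?_
      rw [Setoid.comap_rel]
      have hg := cyc_apply (swap d (f d) * f) u
      rw [Perm.mul_apply] at hg
      by_cases hu : u = d
      · subst hu
        simp [g]
      by_cases hfu : f u = d
      · rw [hfu, swap_apply_left] at hg
        simpa [g, hu, hfu] using hg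
      · rw [swap_apply_of_ne_of_ne hfu (fun h => hu (f.injective h))] at hg
        simpa [g, hu, hfu] using hg
    simpa [Setoid.comap_rel, g, hx, hy] using key h

lemma skip_apply_self {D : Type*} [DecidableEq D] (f : Perm D) (d : D) :
    (swap d (f d) * f) d = d := by simp

lemma skip_apply_of_fixed {D : Type*} [DecidableEq D] {f : Perm D} {x : D} (d : D)
    (hx : f x = x) : (swap d (f d) * f) x = x := by
  by_cases h : x = d
  · subst h; simp
  rw [Perm.mul_apply, hx]
  refine swap_apply_of_ne_of_ne h fun hf => h (f.injective (hx.trans hf))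

/-- A combinatorial map of genus at most one whose darts are the elements of `K`, with edge
involution `inv`, such that two darts issue from the same vertex when their tails are
equivalent under `R`. -/
def IsToricMap {D W : Type*} (inv : D → D) (tail : D → W) (R : Setoid W) (K : Set D) : Prop :=
  ∃ σ α : Perm D, GenusLeOne σ α ∧ (∀ x ∉ K, σ x = x ∧ α x = x) ∧
    (∀ x ∈ K, inv x ∈ K ∧ α x = inv x) ∧
    ∀ x ∈ K, ∀ y ∈ K, cyc σ x y ↔ R (tail x) (tail y)

section Minor

variable {D W : Type*} [Finite D] {inv : D → D} {tail : D → W} {R : Setoid W} {K : Set D}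

lemma IsToricMap.delete (hinv : ∀ x, inv (inv x) = x)
    (h : IsToricMap inv tail R K) {d : D} (hd : d ∈ K) :
    IsToricMap inv tail R (K \ {d, inv d}) := by
  classical
  obtain ⟨σ, α, hg, hout, hin, hR⟩ := h
  have hα : α d = inv d := (hin d hd).2
  have hα' : α (inv d) = d := by rw [(hin _ (hin d hd).1).2, hinv]
  have hαi : α⁻¹ d = inv d := Perm.inv_eq_iff_eq.2 hα'.symm
  have g1 := hg.skip_left d
  have g2 := g1.skip_left (inv d)
  have g3 := g2.skip_right d
  set σ₁ := swap d (σ d) * σ with hσ₁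
  set σ₂ := swap (inv d) (σ₁ (inv d)) * σ₁ with hσ₂
  rw [hαi] at g3
  refine ⟨_, _, g3, ?_, ?_, ?_⟩
  · intro x hx
    by_cases h1 : x = d
    · subst h1
      refine ⟨skip_apply_of_fixed _ (skip_apply_self _ _), ?_⟩
      rw [Perm.mul_apply, swap_apply_left, hα']
    by_cases h2 : x = inv d
    · subst h2
      refine ⟨skip_apply_self _ _, ?_⟩
      rw [Perm.mul_apply, swap_apply_right, hα]
    have hxK : x ∉ K := fun hk => hx ⟨hk, by simp [h1, h2]⟩
    refine ⟨skip_apply_of_fixed _ (skip_apply_of_fixed _ (hout x hxK).1), ?_⟩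
    rw [Perm.mul_apply, swap_apply_of_ne_of_ne h1 h2, (hout x hxK).2]
  · rintro x ⟨hx, hx'⟩
    simp only [Set.mem_insert_iff, Set.mem_singleton_iff, not_or] at hx'
    refine ⟨⟨(hin x hx).1, ?_⟩, ?_⟩
    · simp only [Set.mem_insert_iff, Set.mem_singleton_iff, not_or]
      refine ⟨fun hh => hx'.2 (by rw [← hh, hinv]), fun hh => hx'.1 ?_⟩
      rw [← hinv x, hh, hinv]
    · rw [Perm.mul_apply, swap_apply_of_ne_of_ne hx'.1 hx'.2, (hin x hx).2]
  · rintro x ⟨hx, hx'⟩ y ⟨hy, hy'⟩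
    simp only [Set.mem_insert_iff, Set.mem_singleton_iff, not_or] at hx' hy'
    rw [hσ₂, cyc_skip_iff _ hx'.2 hy'.2, hσ₁, cyc_skip_iff _ hx'.1 hy'.1, hR x hx y hy]

lemma IsToricMap.contract (hinv : ∀ x, inv (inv x) = x)
    (h : IsToricMap inv tail R K) {d : D} (hd : d ∈ K) (hnR : ¬ R (tail d) (tail (inv d))) :
    IsToricMap inv tail (R ⊔ pairSetoid (tail d) (tail (inv d))) (K \ {d, inv d}) := by
  classical
  obtain ⟨σ, α, hg, hout, hin, hR⟩ := h
  have hα : α d = inv d := (hin d hd).2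
  have hdK : inv d ∈ K := (hin d hd).1
  have hα' : α (inv d) = d := by rw [(hin _ hdK).2, hinv]
  have g1 := (hg.transfer_right d).skip_left d
  have g3 := g1.skip_left (inv d)
  rw [hα] at g3
  have hnσ : ¬ cyc σ d (inv d) := by rwa [hR d hd _ hdK]
  have hσ' : cyc (σ * swap d (inv d)) = cyc σ ⊔ pairSetoid d (inv d) := by
    rw [← cyc_mul_swap_sup, sup_pairSetoid_eq (cyc_mul_swap_of_not hnσ)]
  set σ₀ := σ * swap d (inv d) with hσ₀
  set σ₁ := swap d (σ₀ d) * σ₀ with hσ₁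
  set σ₂ := swap (inv d) (σ₁ (inv d)) * σ₁ with hσ₂
  refine ⟨_, _, g3, ?_, ?_, ?_⟩
  · intro x hx
    by_cases h1 : x = d
    · subst h1
      refine ⟨skip_apply_of_fixed _ (skip_apply_self _ _), ?_⟩
      rw [Perm.mul_apply, hα, swap_apply_right]
    by_cases h2 : x = inv d
    · subst h2
      refine ⟨skip_apply_self _ _, ?_⟩
      rw [Perm.mul_apply, hα', swap_apply_left]
    have hxK : x ∉ K := fun hk => hx ⟨hk, by simp [h1, h2]⟩
    refine ⟨skip_apply_of_fixed _ (skip_apply_of_fixed _ ?_), ?_⟩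
    · rw [hσ₀, Perm.mul_apply, swap_apply_of_ne_of_ne h1 h2, (hout x hxK).1]
    · rw [Perm.mul_apply, (hout x hxK).2, swap_apply_of_ne_of_ne h1 h2]
  · rintro x ⟨hx, hx'⟩
    simp only [Set.mem_insert_iff, Set.mem_singleton_iff, not_or] at hx'
    have h1 : inv x ≠ d := fun hh => hx'.2 (by rw [← hh, hinv])
    have h2 : inv x ≠ inv d := fun hh => hx'.1 (by rw [← hinv x, hh, hinv])
    refine ⟨⟨(hin x hx).1, ?_⟩, ?_⟩
    · simp only [Set.mem_insert_iff, Set.mem_singleton_iff, not_or]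
      exact ⟨h1, h2⟩
    · rw [Perm.mul_apply, (hin x hx).2, swap_apply_of_ne_of_ne h1 h2]
  · rintro x ⟨hx, hx'⟩ y ⟨hy, hy'⟩
    simp only [Set.mem_insert_iff, Set.mem_singleton_iff, not_or] at hx' hy'
    rw [hσ₂, cyc_skip_iff _ hx'.2 hy'.2, hσ₁, cyc_skip_iff _ hx'.1 hy'.1, hσ',
      sup_pairSetoid_iff, sup_pairSetoid_iff, hR x hx y hy, hR x hx d hd, hR _ hdK y hy,
      hR x hx _ hdK, hR d hd y hy]

lemma IsToricMap.delete_all (hinv : ∀ x, inv (inv x) = x)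
    (h : IsToricMap inv tail R K) {L : Set D} (hL : ∀ x ∈ L, inv x ∈ L) (hLK : L ⊆ K) :
    IsToricMap inv tail R L := by
  induction hn : (K \ L).ncard using Nat.strong_induction_on generalizing K with
  | _ n ih =>
    by_cases hKL : K ⊆ L
    · rwa [hLK.antisymm hKL]
    obtain ⟨d, hdK, hdL⟩ := Set.not_subset.1 hKL
    have hdL' : inv d ∉ L := fun hh => hdL (by simpa [hinv] using hL _ hh)
    refine ih _ ?_ (h.delete hinv hdK) ?_ rfl
    · rw [← hn]
      refine Set.ncard_lt_ncard ⟨fun x hx => ⟨hx.1.1, hx.2⟩, fun hh => ?_⟩ (Set.toFinite _)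
      exact (hh ⟨hdK, hdL⟩).1.2 (by simp)
    · intro x hx
      refine ⟨hLK hx, ?_⟩
      simp only [Set.mem_insert_iff, Set.mem_singleton_iff, not_or]
      exact ⟨fun hh => hdL (hh ▸ hx), fun hh => hdL' (hh ▸ hx)⟩

/-- The relation on vertices generated by contracting a set of darts. -/
def contraction (inv : D → D) (tail : D → W) (S : Set D) : Setoid W :=
  Relation.EqvGen.setoid fun u v => ∃ d ∈ S, tail d = u ∧ tail (inv d) = v

omit [Finite D] in
lemma contraction_insert (d : D) (S : Set D) :
    contraction inv tail (insert d S) =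
      contraction inv tail S ⊔ pairSetoid (tail d) (tail (inv d)) := by
  refine le_antisymm (Setoid.eqvGen_le ?_) (sup_le (Setoid.eqvGen_le ?_) ?_)
  · rintro _ _ ⟨e, rfl | he, rfl, rfl⟩
    · exact pairSetoid_le_iff.1 le_sup_right
    · exact Setoid.le_def.1 le_sup_left (Relation.EqvGen.rel _ _ ⟨e, he, rfl, rfl⟩)
  · rintro _ _ ⟨e, he, rfl, rfl⟩
    exact Relation.EqvGen.rel _ _ ⟨e, Or.inr he, rfl, rfl⟩
  · exact pairSetoid_le_iff.2 (Relation.EqvGen.rel _ _ ⟨d, Or.inl rfl, rfl, rfl⟩)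

lemma IsToricMap.contract_all (hinv : ∀ x, inv (inv x) = x)
    (h : IsToricMap inv tail ⊥ Set.univ) (S : Set D) :
    ∃ K, IsToricMap inv tail (contraction inv tail S) K ∧
      ∀ d, ¬ contraction inv tail S (tail d) (tail (inv d)) → d ∈ K := by
  induction S, S.toFinite using Set.Finite.induction_on with
  | empty =>
    refine ⟨Set.univ, ?_, fun _ _ => trivial⟩
    have : contraction inv tail ∅ = ⊥ := by
      refine le_bot_iff.1 (Setoid.eqvGen_le ?_)
      rintro _ _ ⟨_, h, _⟩
      exact h.elim
    rwa [this]
  | @insert d S _ _ ih =>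
    obtain ⟨K, hK, hKS⟩ := ih
    rw [contraction_insert]
    by_cases hd : contraction inv tail S (tail d) (tail (inv d))
    · rw [sup_pairSetoid_eq hd]
      exact ⟨K, hK, hKS⟩
    · refine ⟨_, hK.contract hinv (hKS d hd) hd, fun e he => ⟨hKS e fun h' => he ?_, ?_⟩⟩
      · exact Setoid.le_def.1 le_sup_left h'
      · have hp := pairSetoid_le_iff.1 (le_sup_right (a := contraction inv tail S)
          (b := pairSetoid (tail d) (tail (inv d))))
        simp only [Set.mem_insert_iff, Set.mem_singleton_iff, not_or]
        constructor
        · rintro rfl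
          exact he hp
        · rintro rfl
          rw [hinv] at he
          exact he (Setoid.symm' _ hp)

end Minor

/-- Passing to an invariant set of darts which contains all points that are not fixed. -/
lemma cycCount_le_of_embedding {D E : Type*} [Finite D] {δ : E → D}
    (hδ : Function.Injective δ) {f : Perm D} {g : Perm E} (hfg : ∀ x, δ (g x) = f (δ x)) :
    cycCount f + Nat.card E ≤ Nat.card D + cycCount g := by
  classical
  have : Finite E := Finite.of_injective δ hδ
  have hle : cyc g ≤ Setoid.comap δ (cyc f) := by
    refine cyc_le_iff.2 fun x => ?_
    rw [Setoid.comap_rel, hfg]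
    exact cyc_apply f _
  let F : Quotient (cyc g) ⊕ ((Set.range δ)ᶜ : Set D) → Quotient (cyc f) :=
    Sum.elim (Quotient.map δ fun _ _ h => hle h) fun x => Quotient.mk _ x.1
  have hF : Function.Surjective F := by
    rintro ⟨x⟩
    by_cases hx : x ∈ Set.range δ
    · obtain ⟨y, rfl⟩ := hx
      exact ⟨Sum.inl (Quotient.mk _ y), rfl⟩
    · exact ⟨Sum.inr ⟨x, hx⟩, rfl⟩
  have h1 := Nat.card_le_card_of_surjective F hF
  rw [Nat.card_sum] at h1
  have h2 := Set.ncard_add_ncard_compl (Set.range δ)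
  have h3 : (Set.range δ).ncard = Nat.card E := by
    rw [← Nat.card_coe_set_eq, Nat.card_range_of_injective hδ]
  rw [Nat.card_coe_set_eq] at h1
  unfold cycCount classCount
  omega

/-- Euler's inequality for a map of genus at most one supported on the range of `δ`. -/
lemma GenusLeOne.euler {D E : Type*} [Finite D] [Nonempty E] {δ : E → D}
    (hδ : Function.Injective δ) {σ α : Perm D} {s a : Perm E}
    (h : GenusLeOne σ α) (hσ : ∀ x, δ (s x) = σ (δ x)) (hα : ∀ x, δ (a x) = α (δ x))
    (hfix : ∀ x ∉ Set.range δ, σ x = x ∧ α x = x) :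
    Nat.card E ≤ cycCount s + cycCount a + cycCount (s * a) := by
  classical
  have : Finite E := Finite.of_injective δ hδ
  have h1 := cycCount_le_of_embedding hδ hσ
  have h2 := cycCount_le_of_embedding hδ hα
  have h3 := cycCount_le_of_embedding hδ (f := σ * α) (g := s * a) (by simp [hσ, hα])
  have h4 : Nat.card D + 1 ≤ classCount (cyc σ ⊔ cyc α) + Nat.card E := by
    let t : Setoid D := Setoid.ker fun x => if x ∈ Set.range δ then none else some x
    have ht : cyc σ ⊔ cyc α ≤ t := by
      refine sup_le (cyc_le_iff.2 fun x => ?_) (cyc_le_iff.2 fun x => ?_)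
      · by_cases hx : x ∈ Set.range δ
        · obtain ⟨y, rfl⟩ := hx
          simp [t, Setoid.ker_def, ← hσ]
        · rw [(hfix x hx).1]
      · by_cases hx : x ∈ Set.range δ
        · obtain ⟨y, rfl⟩ := hx
          simp [t, Setoid.ker_def, ← hα]
        · rw [(hfix x hx).2]
    have hc := classCount_mono ht
    obtain ⟨e⟩ := ‹Nonempty E›
    let F : Option ((Set.range δ)ᶜ : Set D) → Quotient t := fun o =>
      o.elim (Quotient.mk _ (δ e)) fun x => Quotient.mk _ x.1
    have hF : Function.Injective F := by
      rintro (_ | ⟨x, hx⟩) (_ | ⟨y, hy⟩) hxy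
      · rfl
      · have := Setoid.ker_def.1 (Quotient.exact hxy)
        simp only [Set.mem_range_self, if_true] at this
        rw [if_neg hy] at this
        exact absurd this (by simp)
      · have := Setoid.ker_def.1 (Quotient.exact hxy)
        simp only [Set.mem_range_self, if_true] at this
        rw [if_neg hx] at this
        exact absurd this (by simp)
      · have := Setoid.ker_def.1 (Quotient.exact hxy)
        rw [if_neg hx, if_neg hy] at this
        simpa using this
    have h5 := Nat.card_le_card_of_injective F hF
    rw [Finite.card_option, Nat.card_coe_set_eq] at h5
    have h6 := Set.ncard_add_ncard_compl (Set.range δ)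
    have h7 : (Set.range δ).ncard = Nat.card E := by
      rw [← Nat.card_coe_set_eq, Nat.card_range_of_injective hδ]
    unfold classCount at hc ⊢
    omega
  unfold GenusLeOne at h
  omega

/-- The four unit steps of the square grid on the torus, in cyclic order. -/
def gridStep (N : ℕ) (i : Fin 4) : ZMod N × ZMod N :=
  ![(1, 0), (0, 1), (-1, 0), (0, -1)] i

/-- The darts of the toroidal square grid: a vertex and a direction. -/
abbrev GridDart (N : ℕ) : Type := (ZMod N × ZMod N) × Fin 4

lemma gridStep_add_two (N : ℕ) (i : Fin 4) : gridStep N (i + 2) = -gridStep N i := by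
  fin_cases i <;> simp [gridStep]

/-- The dart opposite to a dart of the toroidal square grid. -/
def gridInv {N : ℕ} (d : GridDart N) : GridDart N := (d.1 + gridStep N d.2, d.2 + 2)

lemma gridInv_gridInv {N : ℕ} (d : GridDart N) : gridInv (gridInv d) = d := by
  obtain ⟨w, i⟩ := d
  have : i + 2 + 2 = i := by fin_cases i <;> rfl
  simp [gridInv, gridStep_add_two, this]

/-- The rotation of the toroidal square grid. -/
def gridRot (N : ℕ) : Perm (GridDart N) := Equiv.prodCongr (Equiv.refl _) (Equiv.addRight 1)

/-- The edge permutation of the toroidal square grid. -/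
def gridEdge (N : ℕ) : Perm (GridDart N) := Function.Involutive.toPerm gridInv gridInv_gridInv

lemma gridRot_apply {N : ℕ} (w : ZMod N × ZMod N) (i : Fin 4) :
    gridRot N (w, i) = (w, i + 1) := rfl

lemma gridEdge_apply {N : ℕ} (w : ZMod N × ZMod N) (i : Fin 4) :
    gridEdge N (w, i) = (w + gridStep N i, i + 2) := rfl

lemma card_le_mul_cycCount {D : Type*} [Finite D] {f : Perm D} {k : ℕ} (hk : 0 < k)
    (hf : f ^ k = 1) : Nat.card D ≤ k * cycCount f := by
  let F : Fin k × Quotient (cyc f) → D := fun p => (f ^ (p.1 : ℕ)) p.2.out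
  have hF : Function.Surjective F := by
    intro x
    obtain ⟨n, hn⟩ : cyc f (Quotient.mk (cyc f) x).out x := Quotient.mk_out x
    have hpos : (0 : ℤ) < k := by exact_mod_cast hk
    have h0 := Int.emod_nonneg n hpos.ne'
    have h1 := Int.emod_lt_of_pos n hpos
    refine ⟨(⟨(n % k).toNat, by omega⟩, Quotient.mk _ x), ?_⟩
    change (f ^ (n % k).toNat) _ = x
    rw [← zpow_natCast, Int.toNat_of_nonneg h0]
    conv_rhs => rw [← hn, ← Int.emod_add_mul_ediv n k, zpow_add, zpow_mul, zpow_natCast, hf,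
      one_zpow, mul_one]
  have := Nat.card_le_card_of_surjective F hF
  rwa [Nat.card_prod, Nat.card_fin] at this

lemma cyc_gridRot {N : ℕ} (x y : GridDart N) : cyc (gridRot N) x y ↔ x.1 = y.1 := by
  constructor
  · have : cyc (gridRot N) ≤ Setoid.ker Prod.fst := cyc_le_iff.2 fun _ => rfl
    exact fun h => this h
  · obtain ⟨w, i⟩ := x
    obtain ⟨w', j⟩ := y
    rintro (rfl : w = w')
    have step : ∀ i, cyc (gridRot N) (w, i) (w, i + 1) := fun i => cyc_apply (gridRot N) (w, i)
    have hj : j = i ∨ j = i + 1 ∨ j = i + 1 + 1 ∨ j = i + 1 + 1 + 1 := by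
      revert i j
      decide
    rcases hj with rfl | rfl | rfl | rfl
    · exact Setoid.refl' _ _
    · exact step i
    · exact Setoid.trans' _ (step i) (step _)
    · exact Setoid.trans' _ (Setoid.trans' _ (step i) (step _)) (step _)

lemma grid_connected (N : ℕ) [NeZero N] (x : GridDart N) :
    (cyc (gridRot N) ⊔ cyc (gridEdge N)) ((0, 0), 0) x := by
  set r := cyc (gridRot N) ⊔ cyc (gridEdge N) with hr
  have rot : ∀ w i j, r (w, i) (w, j) := fun w i j =>
    Setoid.le_def.1 le_sup_left ((cyc_gridRot (N := N) (w, i) (w, j)).2 rfl)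
  have edge : ∀ w i, r (w, 0) (w + gridStep N i, 0) := fun w i =>
    Setoid.trans' _ (rot w 0 i) (Setoid.trans' _
      (Setoid.le_def.1 le_sup_right (cyc_apply (gridEdge N) (w, i))) (rot _ _ _))
  have right : ∀ n : ℕ, r ((0, 0), 0) (((n : ZMod N), 0), 0) := by
    intro n
    induction n with
    | zero => simp
    | succ n ih => simpa [gridStep] using Setoid.trans' _ ih (edge _ 0)
  have up : ∀ a : ZMod N, ∀ n : ℕ, r ((a, 0), 0) ((a, (n : ZMod N)), 0) := by
    intro a n
    induction n with
    | zero => simp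
    | succ n ih => simpa [gridStep] using Setoid.trans' _ ih (edge _ 1)
  obtain ⟨⟨a, b⟩, i⟩ := x
  have h1 := right a.val
  have h2 := up a b.val
  rw [ZMod.natCast_zmod_val] at h1 h2
  exact Setoid.trans' _ h1 (Setoid.trans' _ h2 (rot _ _ _))

lemma grid_genus (N : ℕ) [NeZero N] : GenusLeOne (gridRot N) (gridEdge N) := by
  have h1 : gridRot N ^ 4 = 1 := by
    ext1 ⟨w, i⟩
    have : i + 1 + 1 + 1 + 1 = i := by fin_cases i <;> rfl
    simp [pow_succ, gridRot_apply, this]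
  have h2 : gridEdge N ^ 2 = 1 := by
    ext1 x
    rw [pow_two]
    exact gridInv_gridInv x
  have h3 : (gridRot N * gridEdge N) ^ 4 = 1 := by
    ext1 ⟨w, i⟩
    simp only [pow_succ, pow_zero, one_mul, Perm.mul_apply, gridEdge_apply, gridRot_apply,
      Perm.one_apply]
    fin_cases i <;> simp [gridStep, add_assoc]
  have c1 := card_le_mul_cycCount (by norm_num) h1
  have c2 := card_le_mul_cycCount (by norm_num) h2
  have c3 := card_le_mul_cycCount (by norm_num) h3
  have c4 : classCount (cyc (gridRot N) ⊔ cyc (gridEdge N)) ≤ 1 := by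
    refine Finite.card_le_one_iff_subsingleton.2 ⟨?_⟩
    rintro ⟨x⟩ ⟨y⟩
    exact Quotient.sound (Setoid.trans' _ (Setoid.symm' _ (grid_connected N x))
      (grid_connected N y))
  unfold GenusLeOne
  omega

lemma grid_isToricMap (N : ℕ) [NeZero N] :
    IsToricMap gridInv (Prod.fst : GridDart N → _) ⊥ Set.univ :=
  ⟨gridRot N, gridEdge N, grid_genus N, fun _ h => absurd trivial h,
    fun _ _ => ⟨trivial, rfl⟩, fun x _ y _ => by rw [cyc_gridRot]; rfl⟩

/-- Reversal of darts as a permutation. -/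
def dartSymm {V : Type*} (G : SimpleGraph V) : Perm G.Dart :=
  Function.Involutive.toPerm SimpleGraph.Dart.symm SimpleGraph.Dart.symm_involutive

/-- A minor of a toroidal grid has a rotation system satisfying Euler's inequality. -/
theorem exists_rotation {V : Type*} [Finite V] (G : SimpleGraph V) {N : ℕ} [NeZero N]
    (F : V → Set (ZMod N × ZMod N)) (hdisj : ∀ u v, u ≠ v → Disjoint (F u) (F v))
    (hconn : ∀ u, ∀ w ∈ F u, ∀ w' ∈ F u,
      Relation.EqvGen (fun a b => (∃ i, b = a + gridStep N i) ∧ a ∈ F u ∧ b ∈ F u) w w')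
    (δ : G.Dart → GridDart N) (hδ : ∀ x, δ x.symm = gridInv (δ x))
    (hF : ∀ x, (δ x).1 ∈ F x.fst) [Nonempty G.Dart] :
    ∃ s : Perm G.Dart, (∀ x y, cyc s x y ↔ x.fst = y.fst) ∧
      Nat.card G.Dart ≤ cycCount s + cycCount (dartSymm G) + cycCount (s * dartSymm G) := by
  classical
  have huniq : ∀ {w u v}, w ∈ F u → w ∈ F v → u = v := by
    intro w u v hu hv
    by_contra hne
    exact Set.disjoint_left.1 (hdisj u v hne) hu hv
  have hF' : ∀ x : G.Dart, (gridInv (δ x)).1 ∈ F x.snd := fun x => hδ x ▸ hF x.symm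
  let S : Set (GridDart N) := {d | ∃ u, d.1 ∈ F u ∧ (gridInv d).1 ∈ F u}
  obtain ⟨K, hK, hKS⟩ := (grid_isToricMap N).contract_all gridInv_gridInv S
  have hR : ∀ a b, contraction gridInv Prod.fst S a b → ∀ u, a ∈ F u ↔ b ∈ F u := by
    have : contraction gridInv Prod.fst S ≤ Setoid.ker fun a => {u | a ∈ F u} := by
      refine Setoid.eqvGen_le ?_
      rintro _ _ ⟨d, ⟨v, h1, h2⟩, rfl, rfl⟩
      ext u
      exact ⟨fun h => huniq h1 h ▸ h2, fun h => huniq h2 h ▸ h1⟩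
    intro a b h u
    exact Set.ext_iff.1 (this h) u
  have hR' : ∀ u, ∀ a ∈ F u, ∀ b ∈ F u, contraction gridInv Prod.fst S a b := by
    intro u a ha b hb
    refine Relation.EqvGen.mono (fun a b h => ?_) _ _ (hconn u a ha b hb)
    obtain ⟨⟨i, rfl⟩, h1, h2⟩ := h
    exact ⟨(a, i), ⟨u, h1, h2⟩, rfl, rfl⟩
  have hinj : Function.Injective δ := by
    intro x y hxy
    refine SimpleGraph.Dart.ext _ _ (Prod.ext ?_ ?_)
    · exact huniq (hF x) (hxy ▸ hF y)
    · exact huniq (hF' x) (hxy ▸ hF' y)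
  have : Finite G.Dart := Finite.of_injective δ hinj
  have hmap : IsToricMap gridInv Prod.fst (contraction gridInv Prod.fst S) (Set.range δ) := by
    refine hK.delete_all gridInv_gridInv ?_ ?_
    · rintro _ ⟨x, rfl⟩
      exact ⟨x.symm, hδ x⟩
    · rintro _ ⟨x, rfl⟩
      refine hKS _ fun h => x.adj.ne ?_
      exact huniq ((hR _ _ h _).1 (hF x)) (hF' x)
  obtain ⟨σ, α, hg, hfix, hα, hσ⟩ := hmap
  have hσr : ∀ d, d ∈ Set.range δ ↔ σ d ∈ Set.range δ := by
    intro d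
    by_cases hd : d ∈ Set.range δ
    · refine ⟨fun _ => ?_, fun _ => hd⟩
      by_contra hn
      exact hn ((σ.injective (hfix _ hn).1).symm ▸ hd)
    · rw [(hfix _ hd).1]
  let e := Equiv.ofInjective δ hinj
  let s : Perm G.Dart := (e.trans (σ.subtypePerm fun d => (hσr d).symm)).trans e.symm
  have hs : ∀ x, δ (s x) = σ (δ x) := fun x => by
    have : e (s x) = (σ.subtypePerm fun d => (hσr d).symm) (e x) := e.apply_symm_apply _
    exact congrArg Subtype.val this
  refine ⟨s, fun x y => ?_, hg.euler hinj hs (fun x => ?_) hfix⟩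
  · have hpow : ∀ (n : ℕ) x, δ ((s ^ n) x) = (σ ^ n) (δ x) := by
      intro n
      induction n with
      | zero => exact fun _ => rfl
      | succ n ih => intro x; rw [pow_succ, pow_succ, Perm.mul_apply, ih, hs]; rfl
    have h1 : cyc s x y ↔ cyc σ (δ x) (δ y) := by
      rw [cyc_iff, cyc_iff]
      constructor
      · intro h
        obtain ⟨n, hn⟩ := h.exists_nat_pow_eq
        exact ⟨n, by rw [zpow_natCast, ← hpow, hn]⟩
      · intro h
        obtain ⟨n, hn⟩ := h.exists_nat_pow_eq
        exact ⟨n, by rw [zpow_natCast]; exact hinj ((hpow n x).trans hn)⟩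
    rw [h1, hσ _ ⟨x, rfl⟩ _ ⟨y, rfl⟩]
    constructor
    · exact fun h => huniq ((hR _ _ h _).1 (hF x)) (hF y)
    · exact fun h => hR' x.fst _ (hF x) _ (h ▸ hF y)
  · rw [(hα _ ⟨x, rfl⟩).2]
    exact hδ x

/-- The torus. -/
abbrev Torus : Type := AddCircle (1 : ℝ) × AddCircle (1 : ℝ)

lemma exists_near_circle (N : ℕ) [NeZero N] (z : AddCircle (1 : ℝ)) :
    ∃ a : ZMod N, dist (ZMod.toAddCircle a) z < 1 / N := by
  obtain ⟨x, rfl⟩ := QuotientAddGroup.mk_surjective z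
  have hN : (0 : ℝ) < N := by exact_mod_cast NeZero.pos N
  refine ⟨(⌊x * N⌋ : ℤ), ?_⟩
  rw [ZMod.toAddCircle_intCast, dist_eq_norm]
  refine lt_of_le_of_lt (b := |(⌊x * N⌋ : ℝ) / N - x|) ?_ ?_
  · exact QuotientAddGroup.norm_mk_le_norm
  · have h1 := Int.floor_le (x * N)
    have h2 := Int.lt_floor_add_one (x * N)
    have : (⌊x * N⌋ : ℝ) / N - x = (⌊x * N⌋ - x * N) / N := by field_simp
    rw [this, abs_div, abs_of_pos hN]
    gcongr
    rw [abs_lt]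
    constructor <;> linarith

lemma eq_of_norm_lt (N : ℕ) [NeZero N] (a : ZMod N) (h : ‖ZMod.toAddCircle a‖ < 2 / N) :
    a = 0 ∨ a = 1 ∨ a = -1 := by
  have hN : (0 : ℝ) < N := by exact_mod_cast NeZero.pos N
  rw [ZMod.toAddCircle_apply, AddCircle.norm_eq] at h
  set m := round ((1 : ℝ)⁻¹ * ((a.val : ℝ) / N))
  have h1 : |((a.val : ℤ) - m * N : ℤ)| < 2 := by
    have : ((a.val : ℝ) / N - m * 1) = ((a.val : ℝ) - m * N) / N := by field_simp
    rw [this, abs_div, abs_of_pos hN, div_lt_div_iff_of_pos_right hN] at h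
    exact_mod_cast h
  have h2 : (((a.val : ℤ) - m * N : ℤ) : ZMod N) = a := by simp
  generalize ((a.val : ℤ) - m * N : ℤ) = k at h1 h2
  rw [abs_lt] at h1
  have : k = 0 ∨ k = 1 ∨ k = -1 := by omega
  rcases this with rfl | rfl | rfl <;> simp [← h2]

/-- The point of the torus at a vertex of the grid. -/
noncomputable def gridPt {N : ℕ} [NeZero N] (w : ZMod N × ZMod N) : Torus :=
  (ZMod.toAddCircle w.1, ZMod.toAddCircle w.2)

lemma exists_near (N : ℕ) [NeZero N] (z : Torus) :
    ∃ w : ZMod N × ZMod N, dist (gridPt w) z < 1 / N := by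
  obtain ⟨a, ha⟩ := exists_near_circle N z.1
  obtain ⟨b, hb⟩ := exists_near_circle N z.2
  exact ⟨(a, b), max_lt ha hb⟩

/-- The grid vertices within grid distance of a subset of the torus. -/
def gridHull (N : ℕ) [NeZero N] (A : Set Torus) : Set (ZMod N × ZMod N) :=
  {w | ∃ k ∈ A, dist (gridPt w) k < 1 / N}

/-- Adjacency of grid vertices within a set. -/
def gridRel {N : ℕ} (S : Set (ZMod N × ZMod N)) (a b : ZMod N × ZMod N) : Prop :=
  (∃ i, b = a + gridStep N i) ∧ a ∈ S ∧ b ∈ S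

lemma gridRel.symm {N : ℕ} {S : Set (ZMod N × ZMod N)} {a b : ZMod N × ZMod N}
    (h : gridRel S a b) : gridRel S b a := by
  obtain ⟨⟨i, rfl⟩, ha, hb⟩ := h
  exact ⟨⟨i + 2, by rw [gridStep_add_two, add_neg_cancel_right]⟩, hb, ha⟩

lemma eqvGen_gridRel_of_near {N : ℕ} [NeZero N] {A : Set Torus} {v w : ZMod N × ZMod N}
    {z : Torus} (hz : z ∈ A) (hv : dist (gridPt v) z < 1 / N) (hw : dist (gridPt w) z < 1 / N) :
    Relation.EqvGen (gridRel (gridHull N A)) v w := by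
  obtain ⟨v1, v2⟩ := v
  obtain ⟨w1, w2⟩ := w
  have hv' := max_lt_iff.1 hv
  have hw' := max_lt_iff.1 hw
  have key : ∀ (a b : ZMod N) (y : AddCircle (1 : ℝ)), dist (ZMod.toAddCircle a) y < 1 / N →
      dist (ZMod.toAddCircle b) y < 1 / N → b = a ∨ b = a + 1 ∨ b = a + -1 := by
    intro a b y ha hb
    have : ‖ZMod.toAddCircle (b - a)‖ < 2 / N := by
      rw [map_sub, ← dist_eq_norm]
      refine (dist_triangle_right _ _ y).trans_lt ((add_lt_add hb ha).trans_eq (by ring))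
    rcases eq_of_norm_lt N _ this with h | h | h
    · exact Or.inl (sub_eq_zero.1 h)
    · exact Or.inr (Or.inl (by rw [← h]; abel))
    · exact Or.inr (Or.inr (by rw [← h]; abel))
  have hc : dist (gridPt (v1, w2)) z < 1 / N := max_lt hv'.1 hw'.2
  refine Relation.EqvGen.trans _ (v1, w2) _ ?_ ?_
  · have := key v2 w2 z.2 hv'.2 hw'.2
    rcases this with h | h | h
    · obtain rfl : w2 = v2 := h
      exact Relation.EqvGen.refl _
    · exact Relation.EqvGen.rel _ _ ⟨⟨1, by simp [gridStep, h]⟩, ⟨z, hz, hv⟩, ⟨z, hz, hc⟩⟩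
    · exact Relation.EqvGen.rel _ _ ⟨⟨3, by simp [gridStep, h]⟩, ⟨z, hz, hv⟩, ⟨z, hz, hc⟩⟩
  · have := key v1 w1 z.1 hv'.1 hw'.1
    rcases this with h | h | h
    · obtain rfl : w1 = v1 := h
      exact Relation.EqvGen.refl _
    · exact Relation.EqvGen.rel _ _ ⟨⟨0, by simp [gridStep, h]⟩, ⟨z, hz, hc⟩, ⟨z, hz, hw⟩⟩
    · exact Relation.EqvGen.rel _ _ ⟨⟨2, by simp [gridStep, h]⟩, ⟨z, hz, hc⟩, ⟨z, hz, hw⟩⟩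

lemma gridHull_connected {N : ℕ} [NeZero N] {A : Set Torus} (hA : IsPreconnected A)
    {w w' : ZMod N × ZMod N} (hw : w ∈ gridHull N A) (hw' : w' ∈ gridHull N A) :
    Relation.EqvGen (gridRel (gridHull N A)) w w' := by
  by_contra hn
  let U (P : ZMod N × ZMod N → Prop) : Set Torus := ⋃ v, ⋃ (_ : P v), {z | dist (gridPt v) z < 1 / N}
  have hU : ∀ P, IsOpen (U P) := fun P => isOpen_iUnion fun v => isOpen_iUnion fun _ =>
    isOpen_lt (by fun_prop) continuous_const
  have hmem : ∀ P z, z ∈ U P ↔ ∃ v, P v ∧ dist (gridPt v) z < 1 / N := fun P z => by simp [U]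
  let P := Relation.EqvGen (gridRel (gridHull N A)) w
  have hcover : A ⊆ U P ∪ U fun v => ¬ P v := by
    intro z _
    obtain ⟨v, hv⟩ := exists_near N z
    by_cases h : P v
    · exact Or.inl ((hmem _ _).2 ⟨v, h, hv⟩)
    · exact Or.inr ((hmem _ _).2 ⟨v, h, hv⟩)
  have hne : ∀ (Q : ZMod N × ZMod N → Prop) v, v ∈ gridHull N A → Q v → (A ∩ U Q).Nonempty :=
    fun Q v ⟨k, hk, hd⟩ hv => ⟨k, hk, (hmem _ _).2 ⟨v, hv, hd⟩⟩
  obtain ⟨z, hz, h1, h2⟩ := hA (U P) (U fun v => ¬ P v) (hU _) (hU _) hcover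
    (hne _ w hw (Relation.EqvGen.refl _)) (hne _ w' hw' hn)
  obtain ⟨v, hv, hvz⟩ := (hmem _ _).1 h1
  obtain ⟨v', hv', hvz'⟩ := (hmem _ _).1 h2
  exact hv' (Relation.EqvGen.trans _ _ _ hv (eqvGen_gridRel_of_near hz hvz hvz'))

lemma exists_disjoint_gridHull {I : Type*} [Finite I] (A : I → Set Torus)
    (hA : ∀ i, IsCompact (A i)) : ∃ (N : ℕ) (_ : NeZero N), ∀ i j, Disjoint (A i) (A j) →
      Disjoint (gridHull N (A i)) (gridHull N (A j)) := by
  have h1 : ∀ ij : I × I, ∀ᶠ n : ℕ in Filter.atTop, Disjoint (A ij.1) (A ij.2) →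
      Disjoint (gridHull (n + 1) (A ij.1)) (gridHull (n + 1) (A ij.2)) := by
    rintro ⟨i, j⟩
    by_cases hd : Disjoint (A i) (A j)
    swap
    · exact Filter.Eventually.of_forall fun _ h => absurd h hd
    obtain ⟨ε, hε, ht⟩ := hd.exists_thickenings (hA i) (hA j).isClosed
    obtain ⟨n, hn⟩ := exists_nat_one_div_lt hε
    filter_upwards [Filter.eventually_ge_atTop n] with m hm _
    have hlt : 1 / ((m + 1 : ℕ) : ℝ) < ε := by
      refine lt_of_le_of_lt ?_ hn
      push_cast
      gcongr
    rw [Set.disjoint_left] at ht ⊢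
    rintro w ⟨k, hk, hwk⟩ ⟨l, hl, hwl⟩
    exact ht (Metric.mem_thickening_iff.2 ⟨k, hk, hwk.trans hlt⟩)
      (Metric.mem_thickening_iff.2 ⟨l, hl, hwl.trans hlt⟩)
  obtain ⟨n, hn⟩ := (Filter.eventually_all.2 h1).exists
  exact ⟨n + 1, inferInstance, fun i j h => hn (i, j) h⟩

lemma exists_first_hit {α : Type*} {r : α → α → Prop} {a b : α} {B : Set α}
    (h : Relation.ReflTransGen r a b) (ha : a ∉ B) (hb : b ∈ B) :
    ∃ c d, Relation.ReflTransGen (fun x y => r x y ∧ x ∉ B ∧ y ∉ B) a c ∧ r c d ∧ d ∈ B := by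
  induction h using Relation.ReflTransGen.head_induction_on with
  | refl => exact absurd hb ha
  | @head a a' h1 _ ih =>
    by_cases ha' : a' ∈ B
    · exact ⟨a, a', .refl, h1, ha'⟩
    · obtain ⟨c, d, h2, h3, h4⟩ := ih ha'
      exact ⟨c, d, .head ⟨h1, ha, ha'⟩ h2, h3, h4⟩

lemma reflTransGen_of_eqvGen {α : Type*} {r : α → α → Prop} (hr : ∀ a b, r a b → r b a)
    {a b : α} (h : Relation.EqvGen r a b) : Relation.ReflTransGen r a b := by
  induction h with
  | rel _ _ h => exact .single h
  | refl => exact .refl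
  | symm _ _ _ ih =>
    have : Std.Symm r := ⟨hr⟩
    exact Relation.ReflTransGen.stdSymm.symm _ _ ih
  | trans _ _ _ _ _ h1 h2 => exact h1.trans h2

/-- Thickened vertices and edges in the toroidal grid can be shrunk to a minor model. -/
lemma exists_model_of_hulls {V ι : Type*} {N : ℕ} (src tgt : ι → V)
    (hne : ∀ e, src e ≠ tgt e) (B : V → Set (ZMod N × ZMod N)) (C : ι → Set (ZMod N × ZMod N))
    (hBB : ∀ u v, u ≠ v → Disjoint (B u) (B v)) (hCC : ∀ e f, e ≠ f → Disjoint (C e) (C f))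
    (hCB : ∀ e u, u ≠ src e → u ≠ tgt e → Disjoint (C e) (B u))
    (hB : ∀ u, ∀ w ∈ B u, ∀ w' ∈ B u, Relation.EqvGen (gridRel (B u)) w w')
    (hC : ∀ e, ∀ w ∈ C e, ∀ w' ∈ C e, Relation.EqvGen (gridRel (C e)) w w')
    (hs : ∀ e, (C e ∩ B (src e)).Nonempty) (ht : ∀ e, (C e ∩ B (tgt e)).Nonempty) :
    ∃ (F : V → Set (ZMod N × ZMod N)) (d : ι → GridDart N),
      (∀ u v, u ≠ v → Disjoint (F u) (F v)) ∧
      (∀ u, ∀ w ∈ F u, ∀ w' ∈ F u, Relation.EqvGen (gridRel (F u)) w w') ∧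
      (∀ e, (d e).1 ∈ F (src e) ∧ (gridInv (d e)).1 ∈ F (tgt e)) := by
  choose a ha using hs
  choose b hb using ht
  let r (e : ι) (x y : ZMod N × ZMod N) : Prop :=
    gridRel (C e) x y ∧ x ∉ B (tgt e) ∧ y ∉ B (tgt e)
  have hab : ∀ e, a e ∉ B (tgt e) := fun e =>
    Set.disjoint_left.1 (hBB _ _ (hne e)) (ha e).2
  have hit : ∀ e, ∃ c d, Relation.ReflTransGen (r e) (a e) c ∧ gridRel (C e) c d ∧
      d ∈ B (tgt e) := fun e => exists_first_hit
    (reflTransGen_of_eqvGen (fun _ _ h => h.symm) (hC e _ (ha e).1 _ (hb e).1)) (hab e) (hb e).2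
  choose c d hac hcd hd using hit
  have hstep : ∀ e, ∃ i, d e = c e + gridStep N i := fun e => (hcd e).1
  choose i hi using hstep
  have hP : ∀ e w, Relation.ReflTransGen (r e) (a e) w → w ∈ C e ∧ w ∉ B (tgt e) := by
    intro e w h
    induction h with
    | refl => exact ⟨(ha e).1, hab e⟩
    | tail _ h _ => exact ⟨h.1.2.2, h.2.2⟩
  let F : V → Set (ZMod N × ZMod N) := fun u =>
    {w | w ∈ B u ∨ ∃ e, src e = u ∧ Relation.ReflTransGen (r e) (a e) w}
  have hFlink : ∀ u, ∀ w ∈ F u, ∃ w' ∈ B u, Relation.EqvGen (gridRel (F u)) w' w := by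
    rintro u w (hw | ⟨e, rfl, hw⟩)
    · exact ⟨w, hw, .refl _⟩
    · refine ⟨a e, (ha e).2, ?_⟩
      induction hw with
      | refl => exact .refl _
      | tail h1 h2 ih =>
        exact .trans _ _ _ ih (.rel _ _ ⟨h2.1.1, Or.inr ⟨e, rfl, h1⟩, Or.inr ⟨e, rfl, h1.tail h2⟩⟩)
  have hBP : ∀ u v e w, u ≠ v → src e = v → Relation.ReflTransGen (r e) (a e) w → w ∉ B u := by
    rintro u _ e w huv rfl hw hwu
    obtain ⟨h1, h2⟩ := hP e w hw
    by_cases h : u = tgt e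
    · exact h2 (h ▸ hwu)
    · exact Set.disjoint_left.1 (hCB e u huv h) h1 hwu
  refine ⟨F, fun e => (c e, i e), fun u v huv => ?_, fun u w hw w' hw' => ?_, fun e => ⟨?_, ?_⟩⟩
  · rw [Set.disjoint_left]
    rintro w (hu | ⟨e, he, hu⟩) (hv | ⟨f, hf, hv⟩)
    · exact Set.disjoint_left.1 (hBB u v huv) hu hv
    · exact hBP u v f w huv hf hv hu
    · exact hBP v u e w huv.symm he hu hv
    · have hef : e ≠ f := by
        rintro rfl
        exact huv (he.symm.trans hf)
      exact Set.disjoint_left.1 (hCC e f hef) (hP e w hu).1 (hP f w hv).1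
  · obtain ⟨x, hx, hxw⟩ := hFlink u w hw
    obtain ⟨y, hy, hyw⟩ := hFlink u w' hw'
    refine .trans _ _ _ (.symm _ _ hxw) (.trans _ _ _ ?_ hyw)
    exact Relation.EqvGen.mono (fun a b h => ⟨h.1, Or.inl h.2.1, Or.inl h.2.2⟩) _ _ (hB u x hx y hy)
  · exact Or.inr ⟨e, rfl, hac e⟩
  · exact Or.inl (by simpa [gridInv, ← hi e] using hd e)

lemma exists_short_ends {X : Type*} [TopologicalSpace X] [T2Space X] {x y : X}
    (γ : Path x y) (hxy : x ≠ y) : ∃ s : unitInterval, 0 < s ∧ s < unitInterval.symm s ∧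
      ∀ t t', t ≤ s → unitInterval.symm s ≤ t' → γ t ≠ γ t' := by
  obtain ⟨U, W, hU, hW, hxU, hyW, hd⟩ := t2_separation hxy
  have h0 : Filter.Tendsto (fun n : ℕ => (1 : ℝ) / (n + 1)) Filter.atTop (nhds 0) :=
    tendsto_one_div_add_atTop_nhds_zero_nat
  have hUo : IsOpen (γ.extend ⁻¹' U) := hU.preimage γ.continuous_extend
  have hWo : IsOpen (γ.extend ⁻¹' W) := hW.preimage γ.continuous_extend
  obtain ⟨ε, hε, hεU⟩ := Metric.isOpen_iff.1 hUo 0 (by simpa using hxU)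
  obtain ⟨ε', hε', hεW⟩ := Metric.isOpen_iff.1 hWo 1 (by simpa using hyW)
  obtain ⟨r, hr0, hr⟩ : ∃ r : ℝ, 0 < r ∧ r < ε ∧ r < ε' ∧ r < 1 / 2 :=
    ⟨min (min ε ε') (1 / 2) / 2, by positivity, by
      have h1 := min_le_left (min ε ε') (1 / 2)
      have h2 := min_le_right (min ε ε') (1 / 2)
      have h3 := min_le_left ε ε'
      have h4 := min_le_right ε ε'
      have : 0 < min (min ε ε') (1 / 2) := by positivity
      refine ⟨?_, ?_, ?_⟩ <;> linarith⟩
  refine ⟨⟨r, hr0.le, by linarith⟩, hr0, ?_, ?_⟩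
  · rw [← Subtype.coe_lt_coe, unitInterval.coe_symm_eq]
    change r < 1 - r
    linarith
  · intro t t' ht ht' heq
    rw [← Subtype.coe_le_coe] at ht ht'
    rw [unitInterval.coe_symm_eq] at ht'
    change (t : ℝ) ≤ r at ht
    change 1 - r ≤ (t' : ℝ) at ht'
    have h1 : γ t ∈ U := by
      have : (t : ℝ) ∈ γ.extend ⁻¹' U := hεU (by
        rw [Metric.mem_ball, Real.dist_eq, sub_zero, abs_of_nonneg t.2.1]
        linarith)
      simpa using this
    have h2 : γ t' ∈ W := by
      have : (t' : ℝ) ∈ γ.extend ⁻¹' W := hεW (by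
        rw [Metric.mem_ball, Real.dist_eq, abs_sub_comm, abs_of_nonneg (by linarith [t'.2.2])]
        linarith)
      simpa using this
    exact Set.disjoint_left.1 hd h1 (heq ▸ h2)

/-- A graph embedded in the torus is a minor of a toroidal grid. -/
theorem exists_grid_model {V : Type*} [Finite V] (G : SimpleGraph V) (h : G.IsToroidal) :
    ∃ (N : ℕ) (_ : NeZero N) (F : V → Set (ZMod N × ZMod N)) (δ : G.Dart → GridDart N),
      (∀ u v, u ≠ v → Disjoint (F u) (F v)) ∧
      (∀ u, ∀ w ∈ F u, ∀ w' ∈ F u, Relation.EqvGen (gridRel (F u)) w w') ∧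
      (∀ x, δ x.symm = gridInv (δ x)) ∧ (∀ x, (δ x).1 ∈ F x.fst) := by
  classical
  obtain ⟨p, γ, hp, hγp, hγγ⟩ := h
  let ι := G.edgeSet
  let src (e : ι) : V := (Quot.out e.1).1
  let tgt (e : ι) : V := (Quot.out e.1).2
  have hmk : ∀ e : ι, s(src e, tgt e) = e.1 := fun e => Quot.out_eq e.1
  have hadj : ∀ e : ι, G.Adj (src e) (tgt e) := fun e => by
    rw [← SimpleGraph.mem_edgeSet, hmk]
    exact e.2
  let η (e : ι) := γ _ _ (hadj e)
  have hηp : ∀ e t, t ≠ 0 → t ≠ 1 → ∀ w, η e t ≠ p w := fun e => hγp _ _ (hadj e)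
  have hηη : ∀ e f, e ≠ f → ∀ t t', t ≠ 0 → t ≠ 1 → t' ≠ 0 → t' ≠ 1 → η e t ≠ η f t' :=
    fun e f hef => hγγ _ _ (hadj e) _ _ (hadj f) (by
      rw [hmk, hmk]
      exact fun h => hef (Subtype.ext h))
  have hends := fun e => exists_short_ends (η e) (hp.ne (hadj e).ne)
  choose s hs0 hs1 hs using hends
  have hσ1 : ∀ e, unitInterval.symm (s e) < 1 := fun e => by
    rw [← unitInterval.symm_zero, unitInterval.symm_lt_symm]
    exact hs0 e
  let K (w : V) : Set Torus := {p w} ∪ ((⋃ e, ⋃ (_ : src e = w), η e '' Set.Iic (s e)) ∪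
    ⋃ e, ⋃ (_ : tgt e = w), η e '' Set.Ici (unitInterval.symm (s e)))
  let M (e : ι) : Set Torus := η e '' Set.Icc (s e) (unitInterval.symm (s e))
  have hKmem : ∀ w x, x ∈ K w ↔ x = p w ∨ (∃ e, src e = w ∧ x ∈ η e '' Set.Iic (s e)) ∨
      ∃ e, tgt e = w ∧ x ∈ η e '' Set.Ici (unitInterval.symm (s e)) := by
    intro w x
    simp only [K, Set.mem_union, Set.mem_iUnion, Set.mem_singleton_iff, exists_prop]
  have hKint : ∀ w x, x ∈ K w → x = p w ∨ ∃ e t, t ≠ 0 ∧ t ≠ 1 ∧ x = η e t ∧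
      ((src e = w ∧ t ≤ s e) ∨ (tgt e = w ∧ unitInterval.symm (s e) ≤ t)) := by
    intro w x hx
    rcases (hKmem w x).1 hx with h | ⟨e, rfl, t, ht, rfl⟩ | ⟨e, rfl, t, ht, rfl⟩
    · exact Or.inl h
    · by_cases h0 : t = 0
      · exact Or.inl (by rw [h0]; exact (η e).source)
      · exact Or.inr ⟨e, t, h0, (((show t ≤ s e from ht).trans_lt (hs1 e)).trans (hσ1 e)).ne, rfl,
          Or.inl ⟨rfl, ht⟩⟩
    · by_cases h1 : t = 1
      · exact Or.inl (by rw [h1]; exact (η e).target)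
      · exact Or.inr ⟨e, t, (((hs0 e).trans (hs1 e)).trans_le ht).ne', h1, rfl, Or.inr ⟨rfl, ht⟩⟩
  have hMint : ∀ e x, x ∈ M e → ∃ t, t ≠ 0 ∧ t ≠ 1 ∧ x = η e t := by
    rintro e _ ⟨t, ht, rfl⟩
    exact ⟨t, ((hs0 e).trans_le ht.1).ne', (ht.2.trans_lt (hσ1 e)).ne, rfl⟩
  have hKK : ∀ u v, u ≠ v → Disjoint (K u) (K v) := by
    intro u v huv
    rw [Set.disjoint_left]
    intro x hu hv
    rcases hKint u x hu with hu | ⟨e, t, h0, h1, hx, hu⟩ <;>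
      rcases hKint v x hv with hv | ⟨f, t', h0', h1', hx', hv⟩
    · exact huv (hp (hu.symm.trans hv))
    · exact hηp f t' h0' h1' u (hx'.symm.trans hu)
    · exact hηp e t h0 h1 v (hx.symm.trans hv)
    · by_cases hef : e = f
      · subst hef
        rcases hu with ⟨hu, ht⟩ | ⟨hu, ht⟩ <;> rcases hv with ⟨hv, ht'⟩ | ⟨hv, ht'⟩
        · exact huv (hu.symm.trans hv)
        · exact hs e t t' ht ht' (hx.symm.trans hx')
        · exact hs e t' t ht' ht (hx'.symm.trans hx)
        · exact huv (hu.symm.trans hv)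
      · exact hηη e f hef t t' h0 h1 h0' h1' (hx.symm.trans hx')
  have hMM : ∀ e f, e ≠ f → Disjoint (M e) (M f) := by
    intro e f hef
    rw [Set.disjoint_left]
    intro x he hf
    obtain ⟨t, h0, h1, hx⟩ := hMint e x he
    obtain ⟨t', h0', h1', hx'⟩ := hMint f x hf
    exact hηη e f hef t t' h0 h1 h0' h1' (hx.symm.trans hx')
  have hMK : ∀ e u, u ≠ src e → u ≠ tgt e → Disjoint (M e) (K u) := by
    intro e u h1 h2
    rw [Set.disjoint_left]
    intro x he hu
    obtain ⟨t, ht0, ht1, hx⟩ := hMint e x he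
    rcases hKint u x hu with hu | ⟨f, t', h0', h1', hx', hu⟩
    · exact hηp e t ht0 ht1 u (hx.symm.trans hu)
    · by_cases hef : e = f
      · subst hef
        rcases hu with hu | hu
        · exact h1 hu.1.symm
        · exact h2 hu.1.symm
      · exact hηη e f hef t t' ht0 ht1 h0' h1' (hx.symm.trans hx')
  have hKc : ∀ w, IsCompact (K w) := fun w => isCompact_singleton.union
    ((isCompact_iUnion fun e => isCompact_iUnion fun _ =>
        isClosed_Iic.isCompact.image (η e).continuous).union
      (isCompact_iUnion fun e => isCompact_iUnion fun _ =>
        isClosed_Ici.isCompact.image (η e).continuous))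
  have hMc : ∀ e, IsCompact (M e) := fun e => isCompact_Icc.image (η e).continuous
  have hKp : ∀ w, IsPreconnected (K w) := by
    intro w
    refine isPreconnected_of_forall (p w) fun y hy => ?_
    rcases (hKmem w y).1 hy with rfl | ⟨e, he, hye⟩ | ⟨e, he, hye⟩
    · exact ⟨{p w}, Set.singleton_subset_iff.2 hy, rfl, rfl, isPreconnected_singleton⟩
    · refine ⟨η e '' Set.Iic (s e), fun z hz => (hKmem w z).2 (Or.inr (Or.inl ⟨e, he, hz⟩)),
        ⟨0, (hs0 e).le, he ▸ (η e).source⟩, hye,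
        isPreconnected_Iic.image _ (η e).continuous.continuousOn⟩
    · refine ⟨η e '' Set.Ici (unitInterval.symm (s e)),
        fun z hz => (hKmem w z).2 (Or.inr (Or.inr ⟨e, he, hz⟩)),
        ⟨1, (hσ1 e).le, he ▸ (η e).target⟩, hye,
        isPreconnected_Ici.image _ (η e).continuous.continuousOn⟩
  have hMp : ∀ e, IsPreconnected (M e) := fun e =>
    isPreconnected_Icc.image _ (η e).continuous.continuousOn
  obtain ⟨N, hN, hdisj⟩ := exists_disjoint_gridHull (Sum.elim K M) (by
    rintro (w | e)
    exacts [hKc w, hMc e])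
  have hmeet : ∀ A B : Set Torus, (A ∩ B).Nonempty → (gridHull N A ∩ gridHull N B).Nonempty := by
    rintro A B ⟨z, hA, hB⟩
    obtain ⟨w, hw⟩ := exists_near N z
    exact ⟨w, ⟨z, hA, hw⟩, ⟨z, hB, hw⟩⟩
  obtain ⟨F, d, hF, hFc, hd⟩ := exists_model_of_hulls src tgt (fun e => (hadj e).ne)
    (fun w => gridHull N (K w)) (fun e => gridHull N (M e))
    (fun u v huv => hdisj (.inl u) (.inl v) (hKK u v huv))
    (fun e f hef => hdisj (.inr e) (.inr f) (hMM e f hef))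
    (fun e u h1 h2 => hdisj (.inr e) (.inl u) (hMK e u h1 h2))
    (fun u w hw w' hw' => gridHull_connected (hKp u) hw hw')
    (fun e w hw w' hw' => gridHull_connected (hMp e) hw hw')
    (fun e => hmeet _ _ ⟨η e (s e), ⟨s e, ⟨le_rfl, (hs1 e).le⟩, rfl⟩,
      (hKmem _ _).2 (Or.inr (Or.inl ⟨e, rfl, s e, Set.mem_Iic.2 le_rfl, rfl⟩))⟩)
    (fun e => hmeet _ _ ⟨η e (unitInterval.symm (s e)), ⟨_, ⟨(hs1 e).le, le_rfl⟩, rfl⟩,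
      (hKmem _ _).2 (Or.inr (Or.inr ⟨e, rfl, _, Set.mem_Ici.2 le_rfl, rfl⟩))⟩)
  let E (x : G.Dart) : ι := ⟨x.edge, x.edge_mem⟩
  have hE : ∀ x : G.Dart, E x.symm = E x := fun x => Subtype.ext x.edge_symm
  have hcase : ∀ x : G.Dart, (x.fst = src (E x) ∧ x.snd = tgt (E x)) ∨
      (x.fst = tgt (E x) ∧ x.snd = src (E x)) := fun x => by
    have : s(x.fst, x.snd) = s(src (E x), tgt (E x)) := (hmk (E x)).symm
    exact Sym2.eq_iff.1 this
  refine ⟨N, hN, F, fun x => if x.fst = src (E x) then d (E x) else gridInv (d (E x)), hF, hFc,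
    fun x => ?_, fun x => ?_⟩
  · simp only [hE]
    have hne := (hadj (E x)).ne
    have : x.symm.fst = x.snd := rfl
    rw [this]
    rcases hcase x with ⟨h1, h2⟩ | ⟨h1, h2⟩
    · rw [if_pos h1, if_neg (by rw [h2]; exact hne.symm)]
    · rw [if_pos h2, if_neg (by rw [h1]; exact hne.symm), gridInv_gridInv]
  · dsimp only
    have hne := (hadj (E x)).ne
    rcases hcase x with ⟨h1, h2⟩ | ⟨h1, h2⟩
    · rw [if_pos h1, h1]
      exact (hd _).1
    · rw [if_neg (by rw [h1]; exact hne.symm), h1]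
      exact (hd _).2

lemma sum_quotient_card {D : Type*} [Fintype D] (r : Setoid D) [Fintype (Quotient r)]
    [DecidableEq (Quotient r)] {M : Type*} [AddCommMonoid M] (w : D → M) :
    ∑ x, w x = ∑ q : Quotient r, ∑ x with Quotient.mk r x = q, w x :=
  (Finset.sum_fiberwise _ _ _).symm

lemma iterate_mem_cyc {D : Type*} (f : Perm D) (n : ℕ) (x : D) : cyc f x ((f ^ n) x) :=
  cyc_iff.2 ⟨n, by rw [zpow_natCast]⟩

lemma card_class_ge {D : Type*} [Fintype D] {f : Perm D} [DecidableEq (Quotient (cyc f))] {k : ℕ}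
    {x : D} (hx : ∀ i, 0 < i → i < k → (f ^ i) x ≠ x) :
    k ≤ (Finset.univ.filter fun y => Quotient.mk (cyc f) y = Quotient.mk (cyc f) x).card := by
  classical
  have hinj : Set.InjOn (fun i => (f ^ i) x) (Finset.range k : Set ℕ) := by
    have key : ∀ i j, i < j → j < k → (f ^ i) x ≠ (f ^ j) x := by
      intro i j hij hj h
      refine hx (j - i) (by omega) (by omega) ((f ^ i).injective ?_)
      rw [← Perm.mul_apply, ← pow_add, Nat.add_sub_cancel' hij.le, h]
    intro i hi j hj hij
    simp only [Finset.coe_range, Set.mem_Iio] at hi hj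
    rcases lt_trichotomy i j with h | h | h
    · exact absurd hij (key i j h hj)
    · exact h
    · exact absurd hij.symm (key j i h hi)
  rw [← Finset.card_range k, ← Finset.card_image_of_injOn hinj]
  refine Finset.card_le_card fun y hy => ?_
  obtain ⟨i, -, rfl⟩ := Finset.mem_image.1 hy
  exact Finset.mem_filter.2 ⟨Finset.mem_univ _,
    Quotient.sound (Setoid.symm' _ (iterate_mem_cyc f i x))⟩

lemma two_mul_cycCount_le {D : Type*} [Fintype D] {f : Perm D} (hf : ∀ x, f x ≠ x) :
    2 * cycCount f ≤ Fintype.card D := by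
  classical
  have := sum_quotient_card (cyc f) (fun _ => 1)
  rw [Finset.sum_const, smul_eq_mul, mul_one, Finset.card_univ] at this
  rw [this]
  have h2 : ∀ q : Quotient (cyc f), 2 ≤ ∑ x with Quotient.mk (cyc f) x = q, 1 := by
    rintro ⟨x⟩
    rw [← Finset.card_eq_sum_ones]
    refine card_class_ge fun i h0 h2 => ?_
    obtain rfl : i = 1 := by omega
    simpa using hf x
  refine le_trans ?_ (Finset.sum_le_sum fun q _ => h2 q)
  rw [Finset.sum_const, smul_eq_mul, mul_comm, Finset.card_univ, ← Nat.card_eq_fintype_card]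
  rfl

lemma five_mul_cycCount_le {D : Type*} [Fintype D] [DecidableEq D] {f : Perm D} (h1 : ∀ x, f x ≠ x)
    (h2 : ∀ x, (f ^ 2) x ≠ x) (h4 : ∀ x, (f ^ 4) x ≠ x) :
    5 * cycCount f ≤ Fintype.card D +
      2 * Nat.card {q : Quotient (cyc f) // (f ^ 3) q.out = q.out} := by
  classical
  have := sum_quotient_card (cyc f) (fun _ => 1)
  rw [Finset.sum_const, smul_eq_mul, mul_one, Finset.card_univ] at this
  rw [this, Nat.card_eq_fintype_card, Fintype.card_subtype, Finset.card_filter, Finset.mul_sum,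
    ← Finset.sum_add_distrib]
  have h5 : ∀ q : Quotient (cyc f), 5 ≤ (∑ x with Quotient.mk (cyc f) x = q, 1) +
      2 * if (f ^ 3) q.out = q.out then 1 else 0 := by
    intro q
    rw [← Finset.card_eq_sum_ones]
    have hq : Quotient.mk (cyc f) q.out = q := Quotient.out_eq q
    split_ifs with h
    · have : 3 ≤ (Finset.univ.filter fun y => Quotient.mk (cyc f) y = q).card := by
        conv_rhs => rw [← hq]
        refine card_class_ge fun i h0 h3 => ?_
        interval_cases i
        exacts [h1 _, h2 _]
      omega
    · rw [mul_zero, add_zero]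
      conv_rhs => rw [← hq]
      refine card_class_ge fun i h0 h3 => ?_
      interval_cases i
      exacts [h1 _, h2 _, h, h4 _]
  refine le_trans ?_ (Finset.sum_le_sum fun q _ => h5 q)
  rw [Finset.sum_const, smul_eq_mul, mul_comm, Finset.card_univ, ← Nat.card_eq_fintype_card]
  rfl

section Rotation

lemma face_fst {V : Type*} {G : SimpleGraph V} {s : Perm G.Dart}
    (hs : ∀ x y, cyc s x y ↔ x.fst = y.fst) (d : G.Dart) :
    ((s * dartSymm G) d).fst = d.snd :=
  ((hs _ _).1 (cyc_apply s d.symm)).symm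

variable {V : Type*} [Fintype V] [DecidableEq V] {G : SimpleGraph V} [DecidableRel G.Adj]
  {s : Perm G.Dart}

lemma rotation_two_step_ne (hs : ∀ x y, cyc s x y ↔ x.fst = y.fst) (hdeg : ∀ v, 4 ≤ G.degree v)
    (z : G.Dart) : s (s z) ≠ z := by
  intro h
  have hpow : ∀ n : ℕ, (s ^ n) z = z ∨ (s ^ n) z = s z := by
    intro n
    induction n with
    | zero => exact Or.inl rfl
    | succ n ih =>
      rw [pow_succ', Perm.mul_apply]
      rcases ih with h' | h' <;> rw [h']
      · exact Or.inr rfl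
      · exact Or.inl h
  have hsub : (Finset.univ.filter fun d : G.Dart => d.fst = z.fst) ⊆ {z, s z} := by
    intro d hd
    have hd' := (hs z d).2 (Finset.mem_filter.1 hd).2.symm
    obtain ⟨n, hn⟩ := (cyc_iff.1 hd').exists_nat_pow_eq
    rw [Finset.mem_insert, Finset.mem_singleton, ← hn]
    exact hpow n
  have h1 := (Finset.card_le_card hsub).trans Finset.card_le_two
  rw [G.dart_fst_fiber_card_eq_degree] at h1
  have := hdeg z.fst
  omega

lemma rotation_ne (hs : ∀ x y, cyc s x y ↔ x.fst = y.fst) (hdeg : ∀ v, 4 ≤ G.degree v)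
    (z : G.Dart) : s z ≠ z := fun h =>
  rotation_two_step_ne hs hdeg z (by rw [h, h])

lemma face_snd_ne (hs : ∀ x y, cyc s x y ↔ x.fst = y.fst) (hdeg : ∀ v, 4 ≤ G.degree v)
    (d : G.Dart) : ((s * dartSymm G) d).snd ≠ d.fst := by
  intro h
  refine rotation_ne hs hdeg d.symm (SimpleGraph.Dart.ext _ _ (Prod.ext ?_ h))
  exact face_fst hs d

lemma card_triangular_faces_le (hs : ∀ x y, cyc s x y ↔ x.fst = y.fst)
    (hdeg : ∀ v, 4 ≤ G.degree v) :
    Nat.card {q : Quotient (cyc (s * dartSymm G)) // ((s * dartSymm G) ^ 3) q.out = q.out} ≤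
      (G.cliqueFinset 3).card := by
  set τ := s * dartSymm G with hτ
  have hf : ∀ d : G.Dart, (τ d).fst = d.snd := face_fst hs
  have h3 : ∀ d : G.Dart, (τ ^ 3) d = d → (τ (τ d)).snd = d.fst := fun d h => by
    rw [← hf]
    exact congrArg (fun x : G.Dart => x.fst) h
  have hclique : ∀ d : G.Dart, (τ ^ 3) d = d →
      ({d.fst, d.snd, (τ d).snd} : Finset V) ∈ G.cliqueFinset 3 := by
    intro d h
    rw [SimpleGraph.mem_cliqueFinset_iff, SimpleGraph.is3Clique_triple_iff]
    refine ⟨d.adj, ?_, ?_⟩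
    · have := (τ (τ d)).adj
      rw [hf, h3 d h] at this
      exact this.symm
    · have := (τ d).adj
      rwa [hf] at this
  let g : {q : Quotient (cyc τ) // (τ ^ 3) q.out = q.out} → G.cliqueFinset 3 :=
    fun q => ⟨_, hclique q.1.out q.2⟩
  have hg : Function.Injective g := by
    rintro ⟨p, hp⟩ ⟨q, hq⟩ hpq
    have hset : ({p.out.fst, p.out.snd, (τ p.out).snd} : Finset V) =
        {q.out.fst, q.out.snd, (τ q.out).snd} := congrArg Subtype.val hpq
    rw [Subtype.mk.injEq, ← Quotient.out_eq p, ← Quotient.out_eq q]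
    refine Quotient.sound ?_
    change cyc τ p.out q.out
    clear hpq
    clear g
    generalize p.out = x at *
    generalize q.out = y at *
    have dext : ∀ d e : G.Dart, d.fst = e.fst → d.snd = e.snd → d = e := fun d e h1 h2 =>
      SimpleGraph.Dart.ext _ _ (Prod.ext h1 h2)
    have hcy1 : cyc τ x (τ x) := cyc_apply τ x
    have hcy2 : cyc τ x (τ (τ x)) := Setoid.trans' _ hcy1 (cyc_apply τ _)
    have hrev : ∀ z w : G.Dart, τ w = z → y = z.symm → τ y = w.symm → False := by
      rintro z w h1 rfl h2
      refine rotation_two_step_ne hs hdeg z ?_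
      have h2' : s z = w.symm := by
        rw [hτ, Perm.mul_apply] at h2
        exact h2
      rw [h2']
      exact h1
    have hx1 : x.fst ≠ x.snd := x.adj.ne
    have hx2 : x.snd ≠ (τ x).snd := hf x ▸ (τ x).adj.ne
    have hx3 : x.fst ≠ (τ x).snd := by
      have := (τ (τ x)).adj.ne
      rw [hf, h3 x hp] at this
      exact this.symm
    have hy1 : y.fst ≠ y.snd := y.adj.ne
    have hy2 : y.snd ≠ (τ y).snd := hf y ▸ (τ y).adj.ne
    have hy3 : y.fst ≠ (τ y).snd := by
      have := (τ (τ y)).adj.ne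
      rw [hf, h3 y hq] at this
      exact this.symm
    have m1 : y.fst = x.fst ∨ y.fst = x.snd ∨ y.fst = (τ x).snd := by
      have : y.fst ∈ ({x.fst, x.snd, (τ x).snd} : Finset V) := hset ▸ by simp
      simpa using this
    have m2 : y.snd = x.fst ∨ y.snd = x.snd ∨ y.snd = (τ x).snd := by
      have : y.snd ∈ ({x.fst, x.snd, (τ x).snd} : Finset V) := hset ▸ by simp
      simpa using this
    have m3 : (τ y).snd = x.fst ∨ (τ y).snd = x.snd ∨ (τ y).snd = (τ x).snd := by
      have : (τ y).snd ∈ ({x.fst, x.snd, (τ x).snd} : Finset V) := hset ▸ by simp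
      simpa using this
    rcases m1 with h1 | h1 | h1 <;> rcases m2 with h2 | h2 | h2
    · exact absurd (h1.trans h2.symm) hy1
    · rw [dext y x h1 h2]
    · have h3' : (τ y).snd = x.snd := by grind
      exact (hrev (τ (τ x)) (τ x) rfl (dext _ _ (h1.trans (h3 x hp).symm)
        (h2.trans (hf _).symm)) (dext _ _ ((hf y).trans h2) (h3'.trans (hf x).symm))).elim
    · have h3' : (τ y).snd = (τ x).snd := by grind
      exact (hrev x (τ (τ x)) hp (dext _ _ h1 h2) (dext _ _ ((hf y).trans
        (h2.trans (h3 x hp).symm)) (h3'.trans (hf _).symm))).elim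
    · exact absurd (h1.trans h2.symm) hy1
    · rw [dext y (τ x) (h1.trans (hf x).symm) h2]
      exact hcy1
    · rw [dext y (τ (τ x)) (h1.trans (hf _).symm) (h2.trans (h3 x hp).symm)]
      exact hcy2
    · have h3' : (τ y).snd = x.fst := by grind
      exact (hrev (τ x) x rfl (dext _ _ h1 (h2.trans (hf x).symm))
        (dext _ _ ((hf y).trans h2) h3')).elim
    · exact absurd (h1.trans h2.symm) hy1
  have := Nat.card_le_card_of_injective g hg
  rwa [Nat.card_eq_fintype_card (α := G.cliqueFinset 3), Fintype.card_coe] at this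

/-- Euler's inequality combined with the absence of faces of length four. -/
lemma three_mul_sum_degree_le
    (h4 : ∀ u v a b, u ≠ v → G.Adj u a → G.Adj v a → G.Adj u b → G.Adj v b → a = b)
    (hdeg : ∀ v, 4 ≤ G.degree v) (hs : ∀ x y, cyc s x y ↔ x.fst = y.fst)
    (he : Nat.card G.Dart ≤ cycCount s + cycCount (dartSymm G) + cycCount (s * dartSymm G)) :
    3 * ∑ v, G.degree v ≤ 10 * Fintype.card V + 4 * (G.cliqueFinset 3).card := by
  have hV : cycCount s ≤ Fintype.card V := by
    rw [← Nat.card_eq_fintype_card]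
    refine Nat.card_le_card_of_injective
      (Quotient.lift (fun d : G.Dart => d.fst) fun a b h => (hs a b).1 h) ?_
    rintro ⟨a⟩ ⟨b⟩ h
    exact Quotient.sound ((hs a b).2 h)
  have hE : 2 * cycCount (dartSymm G) ≤ Fintype.card G.Dart :=
    two_mul_cycCount_le fun d => d.symm_ne
  have hf : ∀ d : G.Dart, ((s * dartSymm G) d).fst = d.snd := face_fst hs
  have hsn := face_snd_ne hs hdeg
  have hF := five_mul_cycCount_le (f := s * dartSymm G)
    (fun d h => d.adj.ne ((congrArg (fun x : G.Dart => x.fst) h).symm.trans (hf d)))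
    (fun d h => by
      refine hsn d ?_
      rw [← hf]
      exact congrArg (fun x : G.Dart => x.fst) h)
    (fun d h => by
      generalize s * dartSymm G = τ at *
      have h1 := d.adj
      have h2 := (τ d).adj
      have h3 := (τ (τ d)).adj
      have h5 := (τ (τ (τ d))).adj
      have h6 : (τ (τ (τ d))).snd = d.fst := by
        rw [← hf]
        exact congrArg (fun x : G.Dart => x.fst) h
      have h7 := hsn (τ d)
      rw [h6] at h5
      rw [hf] at h2 h3 h5 h7
      exact h7 (h4 _ _ _ _ (hsn d).symm h1 h2.symm h5.symm h3).symm)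
  have ht := card_triangular_faces_le hs hdeg
  rw [Nat.card_eq_fintype_card] at he
  rw [← G.dart_card_eq_sum_degrees]
  omega

end Rotation

lemma hasCapSubgraph_of_path {V : Type*} [Fintype V] {G : SimpleGraph V} [DecidableRel G.Adj]
    {L : ℕ} (v : ℕ → V) (x : V)
    (hinj : ∀ i j, i < j → j ≤ L → v i ≠ v j) (hadj : ∀ i < L, G.Adj (v i) (v (i + 1)))
    (hclose : G.Adj (v L) (v 0))
    (hchord : ∀ i j, i < j → j ≤ L → G.Adj (v i) (v j) → j = i + 1 ∨ (i = 0 ∧ j = L))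
    (hx : ∀ i ≤ L, x ≠ v i) (hx0 : G.Adj x (v 0)) (hxL : G.Adj x (v L))
    (hxi : ∀ i, 0 < i → i < L → ¬ G.Adj x (v i))
    (hdx : G.degree x = 4) (hd : ∀ i ≤ L, G.degree (v i) = 4) : HasCapSubgraph G (L + 1) := by
  let f (i : ZMod (L + 1)) : ℕ := (i - 1).val
  have hf : ∀ i, f i ≤ L := fun i => Nat.lt_succ_iff.1 (ZMod.val_lt _)
  have hfi : ∀ i, ((f i : ℕ) : ZMod (L + 1)) + 1 = i := fun i => by
    rw [ZMod.natCast_zmod_val, sub_add_cancel]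
  have hL0 : ((L : ℕ) : ZMod (L + 1)) + 1 = 0 := by
    have := ZMod.natCast_self (L + 1)
    rwa [Nat.cast_succ] at this
  have hfnat : ∀ k ≤ L, f ((k : ZMod (L + 1)) + 1) = k := fun k hk => by
    change (((k : ZMod (L + 1)) + 1) - 1).val = k
    rw [add_sub_cancel_right]
    exact ZMod.val_natCast_of_lt (Nat.lt_succ_iff.2 hk)
  have hf0 : f 0 = L := by
    have := hfnat L le_rfl
    rwa [hL0] at this
  have hf1 : f 1 = 0 := by
    have := hfnat 0 (Nat.zero_le _)
    rwa [Nat.cast_zero, zero_add] at this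
  have hfinj : Function.Injective f := fun i j h => by rw [← hfi i, ← hfi j, h]
  have hsucc : ∀ i j, f j = f i + 1 → j = i + 1 := fun i j h => by
    rw [← hfi j, h, Nat.cast_succ, hfi]
  have hnon : ∀ i j : ZMod (L + 1), f i < f j → j ≠ i + 1 → j ≠ i - 1 → ¬ G.Adj (v (f i)) (v (f j)) := by
    intro i j hij h1 h2 h
    rcases hchord _ _ hij (hf j) h with h | ⟨h, h'⟩
    · exact h1 (hsucc i j h)
    · have hi : i = 1 := hfinj (h.trans hf1.symm)
      have hj : j = 0 := hfinj (h'.trans hf0.symm)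
      exact h2 (by rw [hi, hj, sub_self])
  refine ⟨fun i => v (f i), x, fun i j h => ?_, fun i => ?_, fun i j h0 h1 h2 => ?_,
    fun i => hx _ (hf i), ?_, ?_, fun i h0 h1 => ?_, hdx, fun i => hd _ (hf i)⟩
  · rcases lt_trichotomy (f i) (f j) with h' | h' | h'
    · exact absurd h (hinj _ _ h' (hf j))
    · exact hfinj h'
    · exact absurd h.symm (hinj _ _ h' (hf i))
  · dsimp only
    rcases (hf i).lt_or_eq with h | h
    · have : f (i + 1) = f i + 1 := by
        rw [← hfnat (f i + 1) h, Nat.cast_succ, hfi]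
      rw [this]
      exact hadj _ h
    · have hi : i = 0 := hfinj (h.trans hf0.symm)
      rw [hi, zero_add, hf0, hf1]
      exact hclose
  · rcases lt_trichotomy (f i) (f j) with h' | h' | h'
    · exact hnon i j h' h1 h2
    · exact absurd (hfinj h').symm h0
    · refine fun h => hnon j i h' ?_ ?_ h.symm
      · exact fun h => h2 (eq_sub_of_add_eq h.symm)
      · exact fun h => h1 (by rw [h, sub_add_cancel])
  · change G.Adj x (v (f 0))
    rwa [hf0]
  · change G.Adj x (v (f 1))
    rwa [hf1]
  · refine hxi _ (Nat.pos_of_ne_zero fun h => h1 (hfinj (h.trans hf1.symm))) ?_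
    exact lt_of_le_of_ne (hf i) fun h => h0 (hfinj (h.trans hf0.symm))

/-- The edges of `G` between vertices of degree four, without the edges inside `T`. -/
def offGraph {V : Type*} [Fintype V] (G : SimpleGraph V) [DecidableRel G.Adj] (T : Finset V) :
    SimpleGraph V where
  Adj a b := G.Adj a b ∧ G.degree a = 4 ∧ G.degree b = 4 ∧ ¬ (a ∈ T ∧ b ∈ T)
  symm := ⟨fun _ _ h => ⟨h.1.symm, h.2.2.1, h.2.1, fun h' => h.2.2.2 h'.symm⟩⟩
  loopless := ⟨fun _ h => h.1.ne rfl⟩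

lemma exists_cap_of_reachable {V : Type*} [Fintype V] [DecidableEq V] {G : SimpleGraph V}
    [DecidableRel G.Adj]
    (h4 : ∀ u v a b, u ≠ v → G.Adj u a → G.Adj v a → G.Adj u b → G.Adj v b → a = b)
    {T : Finset V} (hT : G.IsNClique 3 T) (hdT : ∀ v ∈ T, G.degree v = 4) {a b : V} (ha : a ∈ T)
    (hb : b ∈ T) (hab : a ≠ b) (hr : (offGraph G T).Reachable a b) :
    ∃ κ, 5 ≤ κ ∧ HasCapSubgraph G κ := by
  classical
  have hex : ∃ n a b, a ∈ T ∧ b ∈ T ∧ a ≠ b ∧ ∃ p : (offGraph G T).Walk a b, p.length = n := by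
    obtain ⟨p⟩ := hr
    exact ⟨p.length, a, b, ha, hb, hab, p, rfl⟩
  clear hr hab hb ha a b
  obtain ⟨a, b, ha, hb, hab, p, hp⟩ := Nat.find_spec hex
  have hmin : ∀ (c d : V), c ∈ T → d ∈ T → c ≠ d → ∀ q : (offGraph G T).Walk c d,
      p.length ≤ q.length := fun c d hc hd hcd q =>
    hp ▸ Nat.find_min' hex ⟨c, d, hc, hd, hcd, q, rfl⟩
  clear hp
  set L := p.length with hL
  have hv0 : p.getVert 0 = a := p.getVert_zero
  have hvL : p.getVert L = b := p.getVert_length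
  have hadjH : ∀ i < L, (offGraph G T).Adj (p.getVert i) (p.getVert (i + 1)) :=
    fun i hi => p.adj_getVert_succ hi
  have hL0 : L ≠ 0 := fun h => hab (hv0.symm.trans ((congrArg p.getVert h).symm.trans hvL))
  have hd : ∀ i ≤ L, G.degree (p.getVert i) = 4 := by
    intro i hi
    rcases hi.lt_or_eq with h | rfl
    · exact (hadjH i h).2.1
    · rw [hvL]
      exact hdT b hb
  have hshort : ∀ i j, i ≤ L → j ≤ L → (offGraph G T).Adj (p.getVert i) (p.getVert j) →
      j ≤ i + 1 := by
    intro i j hi hj h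
    have := hmin a b ha hb hab ((p.take i).append (.cons h (p.drop j)))
    rw [SimpleGraph.Walk.length_append, SimpleGraph.Walk.length_cons,
      SimpleGraph.Walk.take_length, SimpleGraph.Walk.drop_length] at this
    omega
  have hinj : ∀ i j, i < j → j ≤ L → p.getVert i ≠ p.getVert j := by
    intro i j hij hj h
    have := hmin a b ha hb hab ((p.take i).append ((p.drop j).copy h.symm rfl))
    rw [SimpleGraph.Walk.length_append, SimpleGraph.Walk.length_copy,
      SimpleGraph.Walk.take_length, SimpleGraph.Walk.drop_length] at this
    omega
  have hinner : ∀ i, 0 < i → i < L → p.getVert i ∉ T := by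
    intro i h0 hi h
    have hne : p.getVert i ≠ a := fun h => hinj 0 i h0 hi.le (hv0.trans h.symm)
    have := hmin _ _ ha h hne.symm (p.take i)
    rw [SimpleGraph.Walk.take_length] at this
    omega
  have hTadj : ∀ c ∈ T, ∀ d ∈ T, c ≠ d → G.Adj c d := fun c hc d hd h => hT.1 hc hd h
  obtain ⟨x, hxT, hxa, hxb⟩ : ∃ x ∈ T, x ≠ a ∧ x ≠ b := by
    have : ((T.erase a).erase b).Nonempty := by
      rw [← Finset.card_pos, Finset.card_erase_of_mem (Finset.mem_erase.2 ⟨hab.symm, hb⟩),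
        Finset.card_erase_of_mem ha, hT.2]
      norm_num
    obtain ⟨x, hx⟩ := this
    simp only [Finset.mem_erase] at hx
    exact ⟨x, hx.2.2, hx.2.1, hx.1⟩
  have hL1 : L ≠ 1 := by
    intro h
    have := (hadjH 0 (by omega)).2.2.2
    rw [hv0, zero_add, ← h, hvL] at this
    exact this ⟨ha, hb⟩
  have hL2 : L ≠ 2 := by
    intro h
    have e1 := (hadjH 0 (by omega)).1
    have e2 := (hadjH 1 (by omega)).1
    rw [show 1 + 1 = L by omega, hvL] at e2
    rw [hv0, zero_add] at e1
    refine hinner 1 (by omega) (by omega) ?_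
    rw [← h4 a b x _ hab (hTadj _ ha _ hxT hxa.symm) (hTadj _ hb _ hxT hxb.symm) e1 e2.symm]
    exact hxT
  have hL3 : L ≠ 3 := by
    intro h
    have e1 := (hadjH 0 (by omega)).1
    have e2 := (hadjH 1 (by omega)).1
    have e3 := (hadjH 2 (by omega)).1
    rw [show 2 + 1 = L by omega, hvL] at e3
    rw [hv0, zero_add] at e1
    refine hinj 1 L (by omega) le_rfl ?_
    rw [hvL]
    refine h4 a (p.getVert 2) _ _ ?_ e1 e2.symm (hTadj _ ha _ hb hab) e3
    exact fun h => hinj 0 2 (by omega) (by omega) (hv0.trans h)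
  refine ⟨L + 1, by omega, hasCapSubgraph_of_path p.getVert x hinj
    (fun i hi => (hadjH i hi).1) ?_ ?_ ?_ ?_ ?_ ?_ (hdT x hxT) hd⟩
  · rw [hv0, hvL]
    exact (hTadj _ ha _ hb hab).symm
  · intro i j hij hj h
    by_cases hend : i = 0 ∧ j = L
    · exact Or.inr hend
    · refine Or.inl (le_antisymm (hshort i j (by omega) hj
        ⟨h, hd i (by omega), hd j hj, fun hm => ?_⟩) hij)
      by_cases h0 : i = 0
      · exact hinner j (by omega) (by omega) hm.2
      · exact hinner i (by omega) (by omega) hm.1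
  · rintro i hi rfl
    by_cases h0 : i = 0
    · exact hxa (h0 ▸ hv0)
    · by_cases h1 : i = L
      · exact hxb (h1 ▸ hvL)
      · exact hinner i (by omega) (by omega) hxT
  · rw [hv0]
    exact hTadj _ hxT _ ha hxa
  · rw [hvL]
    exact hTadj _ hxT _ hb hxb
  · intro i h0 hi h
    have hH : (offGraph G T).Adj (p.getVert i) x :=
      ⟨h.symm, hd i hi.le, hdT x hxT, fun hm => hinner i h0 hi hm.1⟩
    have h1 := hmin a x ha hxT hxa.symm ((p.take i).append (.cons hH .nil))
    have h2 := hmin x b hxT hb hxb (.cons hH.symm (p.drop i))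
    rw [SimpleGraph.Walk.length_append, SimpleGraph.Walk.length_cons,
      SimpleGraph.Walk.take_length, SimpleGraph.Walk.length_nil] at h1
    rw [SimpleGraph.Walk.length_cons, SimpleGraph.Walk.drop_length] at h2
    omega

section Triangles

variable {V : Type*} [Fintype V] [DecidableEq V] {G : SimpleGraph V} [DecidableRel G.Adj]

lemma exists_third_vertex {T : Finset V} (hT : T ∈ G.cliqueFinset 3) {x y : V} (hx : x ∈ T)
    (hy : y ∈ T) (hxy : x ≠ y) : ∃ z, G.Adj x z ∧ G.Adj y z ∧ T = {x, y, z} := by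
  rw [SimpleGraph.mem_cliqueFinset_iff, SimpleGraph.is3Clique_iff] at hT
  obtain ⟨a, b, c, hab, hac, hbc, rfl⟩ := hT
  simp only [Finset.mem_insert, Finset.mem_singleton] at hx hy
  have e1 : ({a, b, c} : Finset V) = {a, c, b} := by grind
  have e2 : ({a, b, c} : Finset V) = {b, a, c} := by grind
  have e3 : ({a, b, c} : Finset V) = {b, c, a} := by grind
  have e4 : ({a, b, c} : Finset V) = {c, a, b} := by grind
  have e5 : ({a, b, c} : Finset V) = {c, b, a} := by grind
  rcases hx with rfl | rfl | rfl <;> rcases hy with rfl | rfl | rfl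
  · exact absurd rfl hxy
  · exact ⟨c, hac, hbc, rfl⟩
  · exact ⟨b, hab, hbc.symm, e1⟩
  · exact ⟨c, hbc, hac, e2⟩
  · exact absurd rfl hxy
  · exact ⟨a, hab.symm, hac.symm, e3⟩
  · exact ⟨b, hbc.symm, hab, e4⟩
  · exact ⟨a, hac.symm, hab.symm, e5⟩
  · exact absurd rfl hxy

lemma adj_of_mem_triangle {T : Finset V} (hT : T ∈ G.cliqueFinset 3) {x y : V} (hx : x ∈ T)
    (hy : y ∈ T) (hxy : x ≠ y) : G.Adj x y :=
  ((SimpleGraph.mem_cliqueFinset_iff).1 hT).1 hx hy hxy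

lemma triangle_unique
    (h4 : ∀ u v a b, u ≠ v → G.Adj u a → G.Adj v a → G.Adj u b → G.Adj v b → a = b)
    {T T' : Finset V} (hT : T ∈ G.cliqueFinset 3) (hT' : T' ∈ G.cliqueFinset 3) {x y : V}
    (hxy : x ≠ y) (hx : x ∈ T) (hy : y ∈ T) (hx' : x ∈ T') (hy' : y ∈ T') : T = T' := by
  obtain ⟨z, h1, h2, rfl⟩ := exists_third_vertex hT hx hy hxy
  obtain ⟨z', h1', h2', rfl⟩ := exists_third_vertex hT' hx' hy' hxy
  rw [h4 x y z z' hxy h1 h2 h1' h2']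

lemma two_mul_card_triangles_le
    (h4 : ∀ u v a b, u ≠ v → G.Adj u a → G.Adj v a → G.Adj u b → G.Adj v b → a = b) (v : V) :
    2 * ((G.cliqueFinset 3).filter (v ∈ ·)).card ≤ G.degree v := by
  have hdisj : ((((G.cliqueFinset 3).filter (v ∈ ·) : Finset (Finset V)) : Set (Finset V))).PairwiseDisjoint
      (fun T => T.erase v) := by
    intro T hT T' hT' hne
    rw [Finset.mem_coe, Finset.mem_filter] at hT hT'
    rw [Function.onFun, Finset.disjoint_left]
    intro x hx hx'
    rw [Finset.mem_erase] at hx hx'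
    exact hne (triangle_unique h4 hT.1 hT'.1 hx.1 hx.2 hT.2 hx'.2 hT'.2)
  have hcard := Finset.card_biUnion hdisj
  rw [Finset.sum_const_nat (m := 2), mul_comm] at hcard
  · rw [← hcard, ← G.card_neighborFinset_eq_degree]
    refine Finset.card_le_card fun x hx => ?_
    obtain ⟨T, hT, hxT⟩ := Finset.mem_biUnion.1 hx
    rw [Finset.mem_filter] at hT
    rw [Finset.mem_erase] at hxT
    rw [SimpleGraph.mem_neighborFinset]
    exact adj_of_mem_triangle hT.1 hT.2 hxT.2 hxT.1.symm
  · intro T hT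
    rw [Finset.mem_filter] at hT
    rw [Finset.card_erase_of_mem hT.2, ((SimpleGraph.mem_cliqueFinset_iff).1 hT.1).2]

variable (G) in
/-- The triangles of `G` with exactly `k` vertices of degree different from four. -/
def trianglesWith (k : ℕ) : Finset (Finset V) :=
  (G.cliqueFinset 3).filter fun T => (T.filter fun v => G.degree v ≠ 4).card = k

lemma trianglesWith_subset (k : ℕ) : trianglesWith G k ⊆ G.cliqueFinset 3 :=
  Finset.filter_subset _ _

lemma four_mul_card_le
    (h4 : ∀ u v a b, u ≠ v → G.Adj u a → G.Adj v a → G.Adj u b → G.Adj v b → a = b)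
    (hdeg : ∀ v, 4 ≤ G.degree v)
    (h : 3 * ∑ v, G.degree v ≤ 10 * Fintype.card V + 4 * (G.cliqueFinset 3).card) :
    4 * (Finset.univ.filter fun v => G.degree v = 4).card + 
      5 * ∑ T ∈ G.cliqueFinset 3, (T.filter fun v => G.degree v ≠ 4).card ≤
      8 * (G.cliqueFinset 3).card := by
  have hv : ∀ v, 20 + ((if G.degree v = 4 then 4 else 0) +
      5 * if G.degree v ≠ 4 then ((G.cliqueFinset 3).filter (v ∈ ·)).card else 0) ≤
      6 * G.degree v := by
    intro v
    have h1 := hdeg v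
    have h2 := two_mul_card_triangles_le h4 v
    split_ifs <;> omega
  have hsum := Finset.sum_le_sum fun v (_ : v ∈ Finset.univ) => hv v
  rw [Finset.sum_add_distrib, Finset.sum_add_distrib, ← Finset.mul_sum, ← Finset.mul_sum,
    ← Finset.sum_filter, ← Finset.sum_filter, Finset.sum_const, Finset.sum_const,
    Finset.card_univ, smul_eq_mul, smul_eq_mul] at hsum
  have hdc := Finset.sum_card_bipartiteAbove_eq_sum_card_bipartiteBelow
    (s := Finset.univ.filter fun v => G.degree v ≠ 4) (t := G.cliqueFinset 3)
    (fun (v : V) (T : Finset V) => v ∈ T)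
  have hb : ∀ T : Finset V, (Finset.univ.filter fun v => G.degree v ≠ 4).bipartiteBelow
      (fun (v : V) (T : Finset V) => v ∈ T) T = T.filter fun v => G.degree v ≠ 4 := by
    intro T
    ext v
    simp [Finset.mem_bipartiteBelow, and_comm]
  simp only [hb] at hdc
  unfold Finset.bipartiteAbove at hdc
  rw [hdc] at hsum
  omega

lemma four_mul_card_degree_four_le
    (h : 4 * (Finset.univ.filter fun v => G.degree v = 4).card +
      5 * ∑ T ∈ G.cliqueFinset 3, (T.filter fun v => G.degree v ≠ 4).card ≤
      8 * (G.cliqueFinset 3).card) :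
    4 * (Finset.univ.filter fun v => G.degree v = 4).card ≤
      8 * (trianglesWith G 0).card + 3 * (trianglesWith G 1).card := by
  have hT : ∀ T : Finset V, 8 ≤ 5 * (T.filter fun v => G.degree v ≠ 4).card +
      (8 * (if (T.filter fun v => G.degree v ≠ 4).card = 0 then 1 else 0) +
      3 * if (T.filter fun v => G.degree v ≠ 4).card = 1 then 1 else 0) := by
    intro T
    split_ifs <;> omega
  have hsum := Finset.sum_le_sum fun T (_ : T ∈ G.cliqueFinset 3) => hT T
  rw [Finset.sum_add_distrib, Finset.sum_add_distrib, ← Finset.mul_sum, ← Finset.mul_sum,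
    ← Finset.mul_sum, ← Finset.card_filter, ← Finset.card_filter, Finset.sum_const,
    smul_eq_mul] at hsum
  unfold trianglesWith
  omega

lemma exists_degree_four [Nonempty V] (hdeg : ∀ v, 4 ≤ G.degree v)
    (h : 3 * ∑ v, G.degree v ≤ 10 * Fintype.card V + 4 * (G.cliqueFinset 3).card)
    (h' : 4 * (Finset.univ.filter fun v => G.degree v = 4).card +
      5 * ∑ T ∈ G.cliqueFinset 3, (T.filter fun v => G.degree v ≠ 4).card ≤
      8 * (G.cliqueFinset 3).card) : ∃ v, G.degree v = 4 := by
  by_contra! hn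
  have h3 : ∀ T ∈ G.cliqueFinset 3, (T.filter fun v => G.degree v ≠ 4).card = 3 := by
    intro T hT
    rw [Finset.filter_true_of_mem fun v _ => hn v]
    exact ((SimpleGraph.mem_cliqueFinset_iff).1 hT).2
  rw [Finset.sum_const_nat h3] at h'
  have hsum := Finset.sum_le_sum fun v (_ : v ∈ Finset.univ) => hdeg v
  rw [Finset.sum_const, Finset.card_univ, smul_eq_mul] at hsum
  have := Fintype.card_pos (α := V)
  omega

variable (G) in
/-- The equivalence relation on the vertices of degree four generated by a set of triangles. -/
def triangleSetoid (S : Finset (Finset V)) : Setoid {v // G.degree v = 4} :=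
  Relation.EqvGen.setoid fun x y => ∃ T ∈ S, x.1 ∈ T ∧ y.1 ∈ T

omit [DecidableEq V] in
lemma triangleSetoid_le_iff {S : Finset (Finset V)} {r : Setoid {v // G.degree v = 4}} :
    triangleSetoid G S ≤ r ↔ ∀ T ∈ S, ∀ x y : {v // G.degree v = 4}, x.1 ∈ T → y.1 ∈ T → r x y :=
  ⟨fun h T hT _ _ hx hy => h (Relation.EqvGen.rel _ _ ⟨T, hT, hx, hy⟩),
    fun h => Setoid.eqvGen_le fun _ _ ⟨T, hT, hx, hy⟩ => h T hT _ _ hx hy⟩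

omit [DecidableEq V] in
lemma triangleSetoid_rel {S : Finset (Finset V)} {T : Finset V} (hT : T ∈ S)
    {x y : {v // G.degree v = 4}} (hx : x.1 ∈ T) (hy : y.1 ∈ T) : triangleSetoid G S x y :=
  triangleSetoid_le_iff.1 le_rfl T hT x y hx hy

lemma reachable_of_triangleSetoid
    (h4 : ∀ u v a b, u ≠ v → G.Adj u a → G.Adj v a → G.Adj u b → G.Adj v b → a = b)
    {S : Finset (Finset V)} (hS : S ⊆ G.cliqueFinset 3) {T : Finset V}
    (hT : T ∈ G.cliqueFinset 3) (hTS : T ∉ S) {x y : {v // G.degree v = 4}}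
    (h : triangleSetoid G S x y) : (offGraph G T).Reachable x y := by
  have : triangleSetoid G S ≤ (offGraph G T).reachableSetoid.comap Subtype.val := by
    rw [triangleSetoid_le_iff]
    intro T' hT' x y hx hy
    change (offGraph G T).Reachable x y
    by_cases hxy : x.1 = y.1
    · rw [hxy]
    · refine SimpleGraph.Adj.reachable
        ⟨adj_of_mem_triangle (hS hT') hx hy hxy, x.2, y.2, fun hm => hTS ?_⟩
      rwa [triangle_unique h4 hT (hS hT') hxy hm.1 hm.2 hx hy]
  exact this h

lemma classCount_triangleSetoid_add_le
    (h4 : ∀ u v a b, u ≠ v → G.Adj u a → G.Adj v a → G.Adj u b → G.Adj v b → a = b)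
    (hcap : ¬ ∃ κ, 5 ≤ κ ∧ HasCapSubgraph G κ) {S : Finset (Finset V)}
    (hS : S ⊆ trianglesWith G 0) :
    classCount (triangleSetoid G (trianglesWith G 1 ∪ S)) + 2 * S.card ≤
      classCount (triangleSetoid G (trianglesWith G 1)) := by
  induction S using Finset.induction_on with
  | empty => simp
  | insert T S hTS ih =>
    have hT := hS (Finset.mem_insert_self T S)
    have hS' : S ⊆ trianglesWith G 0 := (Finset.subset_insert T S).trans hS
    have ih := ih hS'
    rw [trianglesWith, Finset.mem_filter, Finset.card_eq_zero, Finset.filter_eq_empty_iff] at hT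
    obtain ⟨hTc, hT4⟩ := hT
    have hTd : ∀ v ∈ T, G.degree v = 4 := fun v hv => not_not.1 (hT4 hv)
    have hTU : T ∉ trianglesWith G 1 ∪ S := by
      rw [Finset.mem_union]
      rintro (h | h)
      · have := (Finset.mem_filter.1 h).2
        rw [Finset.filter_false_of_mem fun v hv => hT4 hv] at this
        simp at this
      · exact hTS h
    have hU : trianglesWith G 1 ∪ S ⊆ G.cliqueFinset 3 :=
      Finset.union_subset (trianglesWith_subset 1) (hS'.trans (trianglesWith_subset 0))
    set r := triangleSetoid G (trianglesWith G 1 ∪ S) with hr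
    have hnot : ∀ x y : {v // G.degree v = 4}, x.1 ∈ T → y.1 ∈ T → x.1 ≠ y.1 → ¬ r x y :=
      fun x y hx hy hxy h => hcap (exists_cap_of_reachable h4
        ((SimpleGraph.mem_cliqueFinset_iff).1 hTc) hTd hx hy hxy
        (reachable_of_triangleSetoid h4 hU hTc hTU h))
    obtain ⟨a, b, c, hab, hac, hbc, rfl⟩ :=
      SimpleGraph.is3Clique_iff.1 ((SimpleGraph.mem_cliqueFinset_iff).1 hTc)
    have ha : a ∈ ({a, b, c} : Finset V) := by simp
    have hb : b ∈ ({a, b, c} : Finset V) := by simp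
    have hc : c ∈ ({a, b, c} : Finset V) := by simp
    let x : {v // G.degree v = 4} := ⟨a, hTd a ha⟩
    let y : {v // G.degree v = 4} := ⟨b, hTd b hb⟩
    let z : {v // G.degree v = 4} := ⟨c, hTd c hc⟩
    have hxy := hnot x y ha hb hab.ne
    have hxz := hnot x z ha hc hac.ne
    have hyz := hnot y z hb hc hbc.ne
    have c1 := classCount_sup_pair hxy
    have hxz' : ¬ (r ⊔ pairSetoid x y) x z := by
      rw [sup_pairSetoid_iff]
      rintro (h | ⟨-, h⟩ | ⟨h, -⟩)
      exacts [hxz h, hyz h, hxy h]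
    have c2 := classCount_sup_pair hxz'
    have hle : r ⊔ pairSetoid x y ⊔ pairSetoid x z ≤
        triangleSetoid G (trianglesWith G 1 ∪ insert {a, b, c} S) := by
      have hmem : ({a, b, c} : Finset V) ∈ trianglesWith G 1 ∪ insert {a, b, c} S :=
        Finset.mem_union_right _ (Finset.mem_insert_self _ _)
      refine sup_le (sup_le (triangleSetoid_le_iff.2 fun T hT x y hx hy => ?_) ?_) ?_
      · exact triangleSetoid_rel (Finset.union_subset_union_right
          (Finset.subset_insert _ _) hT) hx hy
      · exact pairSetoid_le_iff.2 (triangleSetoid_rel hmem ha hb)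
      · exact pairSetoid_le_iff.2 (triangleSetoid_rel hmem ha hc)
    have c3 := classCount_mono hle
    rw [Finset.card_insert_of_notMem hTS]
    omega

lemma card_filter_of_mem_trianglesWith_one {T : Finset V} (hT : T ∈ trianglesWith G 1) :
    (T.filter fun v => G.degree v = 4).card = 2 := by
  rw [trianglesWith, Finset.mem_filter] at hT
  have h1 := Finset.card_filter_add_card_filter_not (s := T) (fun v => G.degree v = 4)
  have h2 := ((SimpleGraph.mem_cliqueFinset_iff).1 hT.1).2
  have h3 : (T.filter fun v => ¬ G.degree v = 4).card = 1 := hT.2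
  omega

lemma four_mul_classCount_add_le
    (h4 : ∀ u v a b, u ≠ v → G.Adj u a → G.Adj v a → G.Adj u b → G.Adj v b → a = b) :
    4 * classCount (triangleSetoid G (trianglesWith G 1)) + 3 * (trianglesWith G 1).card ≤
      4 * (Finset.univ.filter fun v => G.degree v = 4).card := by
  classical
  set P := trianglesWith G 1 with hP
  set r := triangleSetoid G P with hr
  have hPc : ∀ T ∈ P, T ∈ G.cliqueFinset 3 := fun T hT => trianglesWith_subset 1 hT
  let n (x : {v // G.degree v = 4}) : ℕ := (P.filter (x.1 ∈ ·)).card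
  have hn : ∀ x, n x ≤ 2 := by
    intro x
    have h1 := two_mul_card_triangles_le h4 x.1
    have h2 : n x ≤ ((G.cliqueFinset 3).filter (x.1 ∈ ·)).card :=
      Finset.card_le_card (Finset.filter_subset_filter _ (trianglesWith_subset 1))
    rw [x.2] at h1
    omega
  let w (x : {v // G.degree v = 4}) : ℕ := 8 - 3 * n x
  have huniq : ∀ {T T' : Finset V}, T ∈ P → T' ∈ P → T ≠ T' → ∀ {x y : {v // G.degree v = 4}},
      x ≠ y → x.1 ∈ T → y.1 ∈ T → x.1 ∈ T' → y.1 ∈ T' → False := by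
    intro T T' hT hT' hne x y hxy h1 h2 h3 h5
    exact hne (triangle_unique h4 (hPc T hT) (hPc T' hT') (fun h => hxy (Subtype.ext h)) h1 h2 h3 h5)
  have hother : ∀ T ∈ P, ∀ x : {v // G.degree v = 4},
      ∃ y : {v // G.degree v = 4}, y ≠ x ∧ y.1 ∈ T := by
    intro T hT x
    have h2 := card_filter_of_mem_trianglesWith_one hT
    obtain ⟨y, hy, hyx⟩ := Finset.exists_mem_ne (h2 ▸ one_lt_two) x.1
    rw [Finset.mem_filter] at hy
    exact ⟨⟨y, hy.2⟩, fun h => hyx (congrArg Subtype.val h), hy.1⟩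
  have hsecond : ∀ x, 2 ≤ n x → ∀ T : Finset V, ∃ T' ∈ P, x.1 ∈ T' ∧ T' ≠ T := by
    intro x hx T
    obtain ⟨T', hT', hne⟩ := Finset.exists_mem_ne (s := P.filter (x.1 ∈ ·)) hx T
    rw [Finset.mem_filter] at hT'
    exact ⟨T', hT'.1, hT'.2, hne⟩
  have hclass : ∀ q : Quotient r, 8 ≤ ∑ y with Quotient.mk r y = q, w y := by
    rintro ⟨x⟩
    have hsub : ∀ S : Finset {v // G.degree v = 4}, (∀ y ∈ S, r x y) → ∑ y ∈ S, w y ≤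
        ∑ y with Quotient.mk r y = Quotient.mk r x, w y := fun S hS =>
      Finset.sum_le_sum_of_subset fun y hy => Finset.mem_filter.2
        ⟨Finset.mem_univ _, Quotient.sound (Setoid.symm' _ (hS y hy))⟩
    suffices h : ∃ S : Finset {v // G.degree v = 4}, (∀ y ∈ S, r x y) ∧ 8 ≤ ∑ y ∈ S, w y by
      obtain ⟨S, h1, h2⟩ := h
      exact h2.trans (hsub S h1)
    have hxx : r x x := Setoid.refl' _ _
    have hnx := hn x
    rcases Nat.eq_zero_or_pos (n x) with h0 | hpos
    · exact ⟨{x}, by simp, by simp [w, h0]⟩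
    obtain ⟨T, hT⟩ := Finset.card_pos.1 hpos
    rw [Finset.mem_filter] at hT
    obtain ⟨hT, hxT⟩ := hT
    obtain ⟨y, hyx, hyT⟩ := hother T hT x
    have hxy : r x y := triangleSetoid_rel hT hxT hyT
    have hny := hn y
    by_cases h1 : n x = 1
    · by_cases h2 : n y ≤ 1
      · refine ⟨{x, y}, by simp [hxy], ?_⟩
        rw [Finset.sum_pair hyx.symm]
        simp only [w]
        omega
      · obtain ⟨T', hT', hyT', hne⟩ := hsecond y (by omega) T
        obtain ⟨z, hzy, hzT'⟩ := hother T' hT' y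
        have hzx : z ≠ x := by
          rintro rfl
          exact huniq hT hT' hne.symm hyx hyT hxT hyT' hzT'
        have hyz : r y z := triangleSetoid_rel hT' hyT' hzT'
        have hnz := hn z
        refine ⟨{x, y, z}, by simp [hxy, Setoid.trans' _ hxy hyz], ?_⟩
        rw [Finset.sum_insert (by simp [hyx.symm, hzx.symm]), Finset.sum_pair hzy.symm]
        simp only [w]
        omega
    · obtain ⟨T', hT', hxT', hne⟩ := hsecond x (by omega) T
      obtain ⟨z, hzx, hzT'⟩ := hother T' hT' x
      have hxz : r x z := triangleSetoid_rel hT' hxT' hzT'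
      have hnz := hn z
      have hyz : y ≠ z := by
        rintro rfl
        exact huniq hT hT' hne.symm hyx hyT hxT hzT' hxT'
      by_cases h2 : n y ≤ 1
      · refine ⟨{x, y, z}, by simp [hxy, hxz], ?_⟩
        rw [Finset.sum_insert (by simp [hyx.symm, hzx.symm]), Finset.sum_pair hyz]
        simp only [w]
        omega
      · obtain ⟨T'', hT'', hyT'', hne'⟩ := hsecond y (by omega) T
        obtain ⟨u, huy, huT''⟩ := hother T'' hT'' y
        have hyu : r y u := triangleSetoid_rel hT'' hyT'' huT''
        have hnu := hn u
        have hux : u ≠ x := by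
          rintro rfl
          exact huniq hT hT'' hne'.symm hyx hyT hxT hyT'' huT''
        have huz : u ≠ z := by
          rintro rfl
          have vne : ∀ {a b : {v // G.degree v = 4}}, a ≠ b → a.1 ≠ b.1 :=
            fun h h' => h (Subtype.ext h')
          have hK : ({x.1, y.1, u.1} : Finset V) ∈ G.cliqueFinset 3 := by
            rw [SimpleGraph.mem_cliqueFinset_iff, SimpleGraph.is3Clique_triple_iff]
            exact ⟨adj_of_mem_triangle (hPc _ hT) hxT hyT (vne hyx.symm),
              adj_of_mem_triangle (hPc _ hT') hxT' hzT' (vne hzx.symm),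
              adj_of_mem_triangle (hPc _ hT'') hyT'' huT'' (vne hyz)⟩
          have e1 := triangle_unique h4 (hPc _ hT) hK (vne hyx) hyT hxT (by simp) (by simp)
          have e2 := triangle_unique h4 (hPc _ hT') hK (vne hzx) hzT' hxT' (by simp) (by simp)
          exact hne (e2.trans e1.symm)
        refine ⟨{x, y, z, u}, by simp [hxy, hxz, Setoid.trans' _ hxy hyu], ?_⟩
        rw [Finset.sum_insert (by simp [hyx.symm, hzx.symm, hux.symm]),
          Finset.sum_insert (by simp [hyz, huy.symm]), Finset.sum_pair huz.symm]
        simp only [w]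
        omega
  have hsum := sum_quotient_card r w
  have hlow : 8 * classCount r ≤ ∑ x, w x := by
    rw [hsum]
    refine le_trans ?_ (Finset.sum_le_sum fun q _ => hclass q)
    rw [Finset.sum_const, smul_eq_mul, mul_comm, Finset.card_univ, ← Nat.card_eq_fintype_card]
    rfl
  have hcard : Fintype.card {v // G.degree v = 4} =
      (Finset.univ.filter fun v => G.degree v = 4).card := Fintype.card_subtype _
  have htot : ∑ x, (w x + 3 * n x) = 8 * Fintype.card {v // G.degree v = 4} := by
    rw [Finset.sum_const_nat (m := 8), Finset.card_univ, mul_comm]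
    intro x _
    have := hn x
    simp only [w]
    omega
  have hdc := Finset.sum_card_bipartiteAbove_eq_sum_card_bipartiteBelow
    (s := (Finset.univ : Finset {v // G.degree v = 4})) (t := P)
    (fun x (T : Finset V) => x.1 ∈ T)
  rw [Finset.sum_const_nat (s := P) (m := 2)] at hdc
  · change ∑ x, n x = _ at hdc
    rw [Finset.sum_add_distrib, ← Finset.mul_sum, hdc] at htot
    omega
  · intro T hT
    rw [← card_filter_of_mem_trianglesWith_one hT,
      ← Finset.card_map (Function.Embedding.subtype fun v => G.degree v = 4)]
    congr 1
    ext v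
    simp [Finset.mem_bipartiteBelow, and_comm]

/-- The combinatorial core: counting triangles contradicts the absence of caps. -/
lemma exists_cap_of_count [Nonempty V]
    (h4 : ∀ u v a b, u ≠ v → G.Adj u a → G.Adj v a → G.Adj u b → G.Adj v b → a = b)
    (hdeg : ∀ v, 4 ≤ G.degree v)
    (h : 3 * ∑ v, G.degree v ≤ 10 * Fintype.card V + 4 * (G.cliqueFinset 3).card) :
    ∃ κ, 5 ≤ κ ∧ HasCapSubgraph G κ := by
  by_contra hcap
  have h1 := four_mul_card_le h4 hdeg h
  have h2 := four_mul_card_degree_four_le h1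
  obtain ⟨v, hv⟩ := exists_degree_four hdeg h h1
  have h3 := classCount_triangleSetoid_add_le h4 hcap (Finset.Subset.refl _)
  have h5 := four_mul_classCount_add_le h4
  have h6 : 0 < classCount (triangleSetoid G (trianglesWith G 1 ∪ trianglesWith G 0)) := by
    have : Nonempty (Quotient (triangleSetoid G (trianglesWith G 1 ∪ trianglesWith G 0))) :=
      ⟨Quotient.mk _ ⟨v, hv⟩⟩
    exact Nat.card_pos
  omega

end Triangles

lemma eq_of_common_neighbors {V : Type*} {G : SimpleGraph V}
    (hC4 : ¬ ∃ c : ZMod 4 → V, Function.Injective c ∧ ∀ i, G.Adj (c i) (c (i + 1)))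
    (u v a b : V) (huv : u ≠ v) (hua : G.Adj u a) (hva : G.Adj v a) (hub : G.Adj u b)
    (hvb : G.Adj v b) : a = b := by
  by_contra hab
  refine hC4 ⟨(![u, a, v, b] : Fin 4 → V), ?_, ?_⟩
  · have h1 := hua.ne
    have h2 := hva.ne
    have h3 := hub.ne
    have h4 := hvb.ne
    intro i j hij
    change Fin 4 at i j
    fin_cases i <;> fin_cases j <;> first | rfl | simp_all
  · intro i
    change Fin 4 at i
    fin_cases i
    exacts [hua, hva.symm, hvb, hub.symm]

end ToroidalC4

/-- Every connected toroidal simple graph with no 4-cycles has a vertex of degree at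
most `3`, or contains a `κ`-cap-subgraph for some `κ ≥ 5`. -/
theorem toroidal_no_four_cycle {V : Type*} [Fintype V] (G : SimpleGraph V)
    [DecidableRel G.Adj] (htor : G.IsToroidal) (hconn : G.Connected)
    (hC4 : ¬ ∃ c : ZMod 4 → V, Function.Injective c ∧ ∀ i, G.Adj (c i) (c (i + 1))) :
    (∃ v, G.degree v ≤ 3) ∨ ∃ κ, 5 ≤ κ ∧ HasCapSubgraph G κ := by
  classical
  by_cases hlow : ∃ v, G.degree v ≤ 3
  · exact Or.inl hlow
  right
  have hdeg : ∀ v, 4 ≤ G.degree v := fun v => by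
    by_contra h
    exact hlow ⟨v, by omega⟩
  have h4 := ToroidalC4.eq_of_common_neighbors hC4
  have : Nonempty V := hconn.nonempty
  obtain ⟨v⟩ := hconn.nonempty
  obtain ⟨w, hw⟩ := (G.degree_pos_iff_exists_adj v).1 (by linarith [hdeg v])
  have : Nonempty G.Dart := ⟨⟨(v, w), hw⟩⟩
  obtain ⟨N, _, F, δ, hdisj, hgrid, hδ, hF⟩ := ToroidalC4.exists_grid_model G htor
  obtain ⟨s, hs, he⟩ := ToroidalC4.exists_rotation G F hdisj hgrid δ hδ hF
  exact ToroidalC4.exists_cap_of_count h4 hdeg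
    (ToroidalC4.three_mul_sum_degree_le h4 hdeg hs he)
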